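/- Fix α ∈ (0,1). For every β ∈ (0,1) the limit I_∞(α,β) := lim_{n→∞} (1/n)(H(y(X^n,D^n)) − H(y(X^n,D^n) | X^n)) exists, and for every ε > 0 there exist constants K > 0 and β₀ > 0 such that for all β ∈ (0, β₀): |I_∞(α,β) − (1 + β log₂ β − β((1 + h₂(α))/α + log₂ e − C))| ≤ K β^{2−ε}. -/

import Mathlib

open Filter

noncomputable section

open scoped Classical

namespace SyncDeletion

/-- The deletion output `y(x, d)`: the subsequence of `x` consisting of the bits `x i`
with `d i = false`, in order. -/
def yList (x d : List Bool) : List Bool :=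
  ((x.zip d).filter (fun p => p.2 = false)).map Prod.fst

/-- Binary entropy function (base-2), with `binEnt 0 = binEnt 1 = 0`. -/
def binEnt (p : ℝ) : ℝ := -(p * Real.logb 2 p) - (1 - p) * Real.logb 2 (1 - p)

/-- The constant `C = ∑_{l≥1} 2^{-l-1} l log₂ l` (the `l = 0` term vanishes). -/
def Cconst : ℝ := ∑' l : ℕ, (2 : ℝ) ^ (-(l : ℝ) - 1) * (l : ℝ) * Real.logb 2 (l : ℝ)

/-- Probability of an event `E` under a pmf `p` on a finite outcome space. -/
def prob {Ω : Type} [Fintype Ω] (p : Ω → ℝ) (E : Ω → Prop) : ℝ :=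
  ∑ ω ∈ Finset.univ.filter E, p ω

/-- Conditional Shannon entropy (in bits) `H(f | g)` of the random variable `f`
given `g`, under the pmf `p`. -/
def condEnt {Ω A B : Type} [Fintype Ω] (p : Ω → ℝ) (f : Ω → A) (g : Ω → B) : ℝ :=
  -∑ ab ∈ Finset.univ.image (fun ω => (f ω, g ω)),
    (if prob p (fun ω => f ω = ab.1 ∧ g ω = ab.2) = 0 then 0
     else prob p (fun ω => f ω = ab.1 ∧ g ω = ab.2) *
       Real.logb 2 (prob p (fun ω => f ω = ab.1 ∧ g ω = ab.2) /
         prob p (fun ω => g ω = ab.2)))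

/-- Shannon entropy (in bits) `H(f)` of the random variable `f` under the pmf `p`. -/
def ent {Ω A : Type} [Fintype Ω] (p : Ω → ℝ) (f : Ω → A) : ℝ :=
  condEnt p f (fun _ => ())

/-- Stationary initial distribution of the deletion-pattern Markov chain:
`P(D₀ = 1) = β/(α+β)`. -/
def initD (α β : ℝ) (b : Bool) : ℝ := if b then β / (α + β) else α / (α + β)

/-- Transition probabilities of the deletion-pattern Markov chain:
`P(1|1) = 1-α`, `P(0|1) = α`, `P(1|0) = β`, `P(0|0) = 1-β`. -/
def transD (α β : ℝ) (b b' : Bool) : ℝ :=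
  if b then (if b' then 1 - α else α) else (if b' then β else 1 - β)

/-- Probability of a trajectory of the stationary two-state Markov chain. -/
def pMarkov (α β : ℝ) {m : ℕ} (dp : Fin (m + 1) → Bool) : ℝ :=
  initD α β (dp 0) * ∏ i : Fin m, transD α β (dp i.castSucc) (dp i.succ)

/-- Joint pmf of the iid Bernoulli(1/2) source `X^n = ω.1` and the independent
deletion pattern `(D_0, …, D_{n+1}) = ω.2`. -/
def pJoint (α β : ℝ) (n : ℕ) (ω : (Fin n → Bool) × (Fin (n + 2) → Bool)) : ℝ :=
  (1 / 2 : ℝ) ^ n * pMarkov α β (m := n + 1) ω.2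

/-- The deletion output `y(X^n, D^n)`: bits `X_i` with `D_i = 0` in order
(source bit `X_i` is governed by pattern bit `D_i`, i.e. index `i` of `ω.2`,
for `i = 1, …, n`). -/
def yOut {n : ℕ} (ω : (Fin n → Bool) × (Fin (n + 2) → Bool)) : List Bool :=
  yList (List.ofFn ω.1)
    (List.ofFn (fun i : Fin n => ω.2 ⟨i.val + 1, by have := i.isLt; omega⟩))

/-- `a_n = H(X^n | y(X^n, D^n), D_0, D_{n+1})`. -/
def aSeq (α β : ℝ) (n : ℕ) : ℝ :=
  condEnt (pJoint α β n) (fun ω => ω.1)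
    (fun ω => (yOut ω, ω.2 0, ω.2 (Fin.last (n + 1))))

/-- `E_n = H(D_1 | D_0, X^n, y(X^n, D^n), D_{n+1})`. -/
def Eseq (α β : ℝ) (n : ℕ) : ℝ :=
  condEnt (pJoint α β n) (fun ω => ω.2 1)
    (fun ω => (ω.2 0, ω.1, yOut ω, ω.2 (Fin.last (n + 1))))

/-- `H(y(X^n, D^n) | X^n, D_0, D_{n+1})`. -/
def hygSeq (α β : ℝ) (n : ℕ) : ℝ :=
  condEnt (pJoint α β n) (fun ω => yOut ω)
    (fun ω => (ω.1, ω.2 0, ω.2 (Fin.last (n + 1))))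

/-- `J_n = d + (1/n) H(y(X^n, D^n) | X^n, D_0, D_{n+1})` with `d = β/(α+β)`. -/
def Jseq (α β : ℝ) (n : ℕ) : ℝ := β / (α + β) + hygSeq α β n / n

/-- `I_n/n`: the normalized mutual information
`(1/n)(H(y(X^n,D^n)) - H(y(X^n,D^n)|X^n))`. -/
def Iseq (α β : ℝ) (n : ℕ) : ℝ :=
  (ent (pJoint α β n) (fun ω => yOut ω) -
    condEnt (pJoint α β n) (fun ω => yOut ω) (fun ω => ω.1)) / n

/-- Error probability of a code `(enc, dec)` with message set `Fin M`. -/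
def errProb (α β : ℝ) (n M : ℕ) (enc : (Fin n → Bool) → Fin M)
    (dec : Fin M × List Bool → (Fin n → Bool)) : ℝ :=
  prob (pJoint α β n) (fun ω => dec (enc ω.1, yOut ω) ≠ ω.1)

/-- `R` is an achievable rate: there is a sequence of codes whose error probability
tends to `0` and whose rate `(1/n) log₂ |M_n|` has limsup at most `R`. -/
def IsAchievable (α β R : ℝ) : Prop :=
  ∃ M : ℕ → ℕ, ∃ enc : (n : ℕ) → (Fin n → Bool) → Fin (M n),
    ∃ dec : (n : ℕ) → Fin (M n) × List Bool → (Fin n → Bool),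
      Tendsto (fun n => errProb α β n (M n) (enc n) (dec n)) atTop (nhds 0) ∧
      Filter.limsup (fun n : ℕ => Real.logb 2 (M n : ℝ) / (n : ℝ)) atTop ≤ R

/-- The minimum achievable rate `R_min(α, β)`. -/
def Rmin (α β : ℝ) : ℝ := sInf {R : ℝ | IsAchievable α β R}

/-- `k = max {6, -6 / log₂(1-α)}`. -/
def kconst (α : ℝ) : ℝ := max 6 (-6 / Real.logb 2 (1 - α))

/-- `m = ⌊-k log₂ β⌋`. -/
def mlen (α β : ℝ) : ℕ := ⌊kconst α * (-Real.logb 2 β)⌋₊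

/-- Number of ones among the entries of `dp` with index `≤ m`. -/
def onesCount {N : ℕ} (dp : Fin N → Bool) (m : ℕ) : ℕ :=
  (Finset.univ.filter (fun i : Fin N => i.val ≤ m ∧ dp i = true)).card

/-- Number of maximal runs of 1's among the entries of `dp` with index `≤ m`
(counted by their starting positions). -/
def runsCount {N : ℕ} (dp : Fin N → Bool) (m : ℕ) : ℕ :=
  (Finset.univ.filter (fun i : Fin N => i.val ≤ m ∧ dp i = true ∧
    (i.val = 0 ∨ dp ⟨i.val - 1, lt_of_le_of_lt (Nat.sub_le _ _) i.isLt⟩ = false))).card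

/-- The deletion pattern `(D_0, …, D_{n+1})` is typical: `(D_0, …, D_m)` contains at
most one maximal run of 1's and at most `⌊(k/3)(-log₂ β)⌋` ones, for `m = ⌊-k log₂ β⌋`. -/
def Typical (α β : ℝ) {n : ℕ} (dp : Fin (n + 2) → Bool) : Prop :=
  runsCount dp (mlen α β) ≤ 1 ∧
    onesCount dp (mlen α β) ≤ ⌊(kconst α / 3) * (-Real.logb 2 β)⌋₊

/-- The joint pmf conditioned on the event `{T = 1}` that the deletion pattern is typical. -/
def pTypCond (α β : ℝ) (n : ℕ) (ω : (Fin n → Bool) × (Fin (n + 2) → Bool)) : ℝ :=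
  if Typical α β ω.2 then
    pJoint α β n ω / prob (pJoint α β n) (fun ω' => Typical α β ω'.2)
  else 0

/-- `H(D_1 | X^n, y(X^n,D^n), D_0, D_{n+1}, T = 1) ⬝ P(T = 1)`. -/
def EseqTyp (α β : ℝ) (n : ℕ) : ℝ :=
  condEnt (pTypCond α β n) (fun ω => ω.2 1)
    (fun ω => (ω.2 0, ω.1, yOut ω, ω.2 (Fin.last (n + 1)))) *
  prob (pJoint α β n) (fun ω => Typical α β ω.2)

/-- `(1/k) H(X_2^{k-1} | y(X_2^{k-1}, D_2^{k-1}), D_1, D_k)` (unnormalized). -/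
def innerEnt (α β : ℝ) (k : ℕ) : ℝ :=
  condEnt (pJoint α β k)
    (fun ω => (fun i : Fin (k - 2) => ω.1 ⟨i.val + 1, by have := i.isLt; omega⟩))
    (fun ω =>
      (yList (List.ofFn (fun i : Fin (k - 2) => ω.1 ⟨i.val + 1, by have := i.isLt; omega⟩))
        (List.ofFn (fun i : Fin (k - 2) => ω.2 ⟨i.val + 2, by have := i.isLt; omega⟩)),
       ω.2 1, ω.2 ⟨k, by omega⟩))
/-! ### Two-point entropy of an unnormalized pair of weights -/

/-- The entropy (in nats) of a pair of nonnegative weights, not normalized to total mass one. -/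
def eta (a b : ℝ) : ℝ := Real.negMulLog a + Real.negMulLog b - Real.negMulLog (a + b)

lemma mul_log_ratio_le {a s q : ℝ} (ha : 0 ≤ a) (hs : a ≤ s) (hq : 0 < q) :
    a * Real.log s + a * Real.log q - a * Real.log a ≤ s * q - a := by
  rcases ha.eq_or_lt with rfl | ha
  · simp; positivity
  · have hs' : 0 < s := ha.trans_le hs
    have h := Real.log_le_sub_one_of_pos (x := s * q / a) (by positivity)
    rw [Real.log_div (by positivity) ha.ne', Real.log_mul hs'.ne' hq.ne'] at h
    have h2 := mul_le_mul_of_nonneg_left h ha.le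
    have h3 : a * (s * q / a - 1) = s * q - a := by field_simp
    linarith

/-- Gibbs' inequality. -/
lemma eta_le_cross {a b q q' : ℝ} (ha : 0 ≤ a) (hb : 0 ≤ b) (hq : 0 < q) (hq' : 0 < q')
    (h : q + q' = 1) : eta a b ≤ a * -Real.log q + b * -Real.log q' := by
  have h1 := mul_log_ratio_le (s := a + b) ha (by linarith) hq
  have h2 := mul_log_ratio_le (s := a + b) hb (by linarith) hq'
  have h3 : (a + b) * q + (a + b) * q' = a + b := by rw [← mul_add, h, mul_one]
  simp only [eta, Real.negMulLog]
  linarith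

@[simp] lemma eta_zero_left (b : ℝ) : eta 0 b = 0 := by simp [eta]

@[simp] lemma eta_zero_right (a : ℝ) : eta a 0 = 0 := by simp [eta]

lemma eta_mul (c a b : ℝ) : eta (c * a) (c * b) = c * eta a b := by
  simp only [eta, ← mul_add, Real.negMulLog_mul]
  ring

lemma eta_nonneg {a b : ℝ} (ha : 0 ≤ a) (hb : 0 ≤ b) : 0 ≤ eta a b := by
  rcases ha.eq_or_lt with rfl | ha
  · simp
  rcases hb.eq_or_lt with rfl | hb
  · simp
  have h1 := Real.log_le_log ha (show a ≤ a + b by linarith)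
  have h2 := Real.log_le_log hb (show b ≤ a + b by linarith)
  simp only [eta, Real.negMulLog]
  nlinarith

lemma eta_eq_cross {a b : ℝ} (ha : 0 < a) (hb : 0 < b) :
    eta a b = a * -Real.log (a / (a + b)) + b * -Real.log (b / (a + b)) := by
  rw [Real.log_div ha.ne' (by positivity), Real.log_div hb.ne' (by positivity)]
  simp only [eta, Real.negMulLog]
  ring

/-- Superadditivity of the two-point entropy. -/
lemma eta_add_le {a b a' b' : ℝ} (ha : 0 ≤ a) (hb : 0 ≤ b) (ha' : 0 ≤ a') (hb' : 0 ≤ b') :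
    eta a b + eta a' b' ≤ eta (a + a') (b + b') := by
  rcases (add_nonneg ha ha').eq_or_lt with h | h
  · obtain rfl : a = 0 := by linarith
    obtain rfl : a' = 0 := by linarith
    simp
  rcases (add_nonneg hb hb').eq_or_lt with h2 | h2
  · obtain rfl : b = 0 := by linarith
    obtain rfl : b' = 0 := by linarith
    simp
  have hsum : (a + a') / (a + a' + (b + b')) + (b + b') / (a + a' + (b + b')) = 1 := by
    field_simp
  have e1 := eta_le_cross ha hb (q := (a + a') / (a + a' + (b + b')))
    (q' := (b + b') / (a + a' + (b + b'))) (by positivity) (by positivity) hsum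
  have e2 := eta_le_cross ha' hb' (q := (a + a') / (a + a' + (b + b')))
    (q' := (b + b') / (a + a' + (b + b'))) (by positivity) (by positivity) hsum
  rw [eta_eq_cross h h2]
  linarith

lemma eta_mono {a b a' b' : ℝ} (ha : 0 ≤ a) (hb : 0 ≤ b) (ha' : a ≤ a') (hb' : b ≤ b') :
    eta a b ≤ eta a' b' := by
  have h := eta_add_le ha hb (sub_nonneg.2 ha') (sub_nonneg.2 hb')
  have h2 := eta_nonneg (sub_nonneg.2 ha') (sub_nonneg.2 hb')
  simp only [add_sub_cancel] at h
  linarith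

lemma eta_le_add {a b : ℝ} (ha : 0 ≤ a) (hb : 0 ≤ b) : eta a b ≤ a + b := by
  have h := eta_le_cross ha hb (q := 1 / 2) (q' := 1 / 2) (by norm_num) (by norm_num) (by norm_num)
  have h1 : -Real.log (1 / 2) ≤ 1 := by
    rw [one_div, Real.log_inv, neg_neg]
    have := Real.log_two_lt_d9
    linarith
  nlinarith [mul_le_mul_of_nonneg_left h1 ha, mul_le_mul_of_nonneg_left h1 hb]

/-! ### The entropy contributed by an ambiguity class and the constant `C` -/

/-- `r + 1` times the entropy of the Bernoulli(`1 / (r + 1)`) law, in nats. -/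
def classEnt (r : ℕ) : ℝ := ((r : ℝ) + 1) * Real.log (r + 1) - r * Real.log r

lemma eta_mul_natCast (w : ℝ) (r : ℕ) : eta w (w * r) = w * classEnt r := by
  have h := eta_mul w 1 r
  rw [mul_one] at h
  rw [h]
  simp only [eta, Real.negMulLog, classEnt, Real.log_one, add_comm (1 : ℝ)]
  ring

@[simp] lemma classEnt_zero : classEnt 0 = 0 := by simp [classEnt]

lemma classEnt_eq {r : ℕ} (hr : 0 < r) :
    classEnt r = Real.log (r + 1) + r * Real.log (((r : ℝ) + 1) / r) := by
  have : (0 : ℝ) < r := by exact_mod_cast hr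
  rw [Real.log_div (by positivity) this.ne', classEnt]
  ring

/-- The increment of `classEnt`. -/
def classInc (l : ℕ) : ℝ := classEnt (l + 1) - classEnt l

lemma mul_log_succ_div_le_one {r : ℕ} (hr : 0 < r) :
    (r : ℝ) * Real.log (((r : ℝ) + 1) / r) ≤ 1 := by
  have h0 : (0 : ℝ) < r := by exact_mod_cast hr
  have h := Real.log_le_sub_one_of_pos (x := ((r : ℝ) + 1) / r) (by positivity)
  have h2 := mul_le_mul_of_nonneg_left h h0.le
  have h3 : (r : ℝ) * (((r : ℝ) + 1) / r - 1) = 1 := by field_simp; ring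
  linarith

lemma classInc_le_two (l : ℕ) : classInc l ≤ 2 := by
  have hlog2 := Real.log_two_lt_d9
  rcases Nat.eq_zero_or_pos l with rfl | hl
  · simp [classInc, classEnt]
    norm_num
    linarith
  · have h0 : (0 : ℝ) < l := by exact_mod_cast hl
    rw [classInc, classEnt_eq hl, classEnt_eq (Nat.succ_pos l)]
    have h1 := mul_log_succ_div_le_one (Nat.succ_pos l)
    have h2 : 0 ≤ (l : ℝ) * Real.log (((l : ℝ) + 1) / l) := by
      apply mul_nonneg h0.le
      apply Real.log_nonneg
      rw [le_div_iff₀ h0]; linarith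
    have h3 : Real.log (((l + 1 : ℕ) : ℝ) + 1) ≤ Real.log 2 + Real.log ((l : ℝ) + 1) := by
      rw [← Real.log_mul (by norm_num) (by positivity)]
      apply Real.log_le_log (by positivity)
      push_cast; linarith
    linarith

lemma classInc_nonneg (l : ℕ) : 0 ≤ classInc l := by
  have hconv := Real.convexOn_mul_log
  have h := hconv.2 (show (l : ℝ) ∈ Set.Ici 0 from Set.mem_Ici.2 (Nat.cast_nonneg l))
    (show (l : ℝ) + 2 ∈ Set.Ici 0 from Set.mem_Ici.2 (by positivity))
    (show (0 : ℝ) ≤ 1 / 2 by norm_num) (show (0 : ℝ) ≤ 1 / 2 by norm_num) (by norm_num)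
  simp only [smul_eq_mul] at h
  have e : 1 / 2 * (l : ℝ) + 1 / 2 * ((l : ℝ) + 2) = l + 1 := by ring
  rw [e] at h
  simp only [classInc, classEnt]
  push_cast
  have e2 : (l : ℝ) + 1 + 1 = l + 2 := by ring
  rw [e2]
  linarith

lemma classEnt_mono : Monotone classEnt :=
  monotone_nat_of_le_succ fun l => by have := classInc_nonneg l; rw [classInc] at this; linarith

lemma classEnt_nonneg (l : ℕ) : 0 ≤ classEnt l := by
  simpa using classEnt_mono (Nat.zero_le l)

/-- Layer-cake decomposition of `classEnt`, truncated at `h`. -/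
lemma sum_classInc_ite (h r : ℕ) :
    ∑ l ∈ Finset.range h, (if l + 1 ≤ r then classInc l else 0) = classEnt (min h r) := by
  induction h with
  | zero => simp
  | succ h ih =>
    rw [Finset.sum_range_succ, ih]
    split_ifs with hr
    · rw [min_eq_left (by omega), min_eq_left hr, classInc]; ring
    · rw [min_eq_right (by omega), min_eq_right (by omega), add_zero]

/-- The partial sums `∑_{l ≤ h} 2^{-l} (classEnt l - classEnt (l - 1))`. -/
def partC (h : ℕ) : ℝ := ∑ l ∈ Finset.range h, (1 / 2 : ℝ) ^ (l + 1) * classInc l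

lemma partC_mono : Monotone partC := monotone_nat_of_le_succ fun h => by
  rw [partC, partC, Finset.sum_range_succ]
  have := classInc_nonneg h
  have : 0 ≤ (1 / 2 : ℝ) ^ (h + 1) * classInc h := by positivity
  linarith

lemma partC_add_antitone : Antitone fun h => partC h + 2 * (1 / 2 : ℝ) ^ h :=
  antitone_nat_of_succ_le fun h => by
    rw [partC, partC, Finset.sum_range_succ]
    have h2 := mul_le_mul_of_nonneg_left (classInc_le_two h)
      (show (0 : ℝ) ≤ (1 / 2 : ℝ) ^ (h + 1) by positivity)
    rw [pow_succ] at *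
    linarith

/-- The constant `C` in nats. -/
def Cnat : ℝ := Cconst * Real.log 2

lemma partC_eq (h : ℕ) :
    partC h = ∑ l ∈ Finset.range (h + 1), (1 / 2 : ℝ) ^ (l + 1) * (l * Real.log l) +
      ((1 / 2 : ℝ) ^ h * (((h : ℝ) + 1) * Real.log (h + 1)) -
        (1 / 2 : ℝ) ^ (h + 1) * (h * Real.log h)) := by
  induction h with
  | zero => simp [partC]
  | succ h ih =>
    rw [partC, Finset.sum_range_succ, ← partC, ih, Finset.sum_range_succ _ (h + 1)]
    simp only [classInc, classEnt, pow_succ]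
    push_cast
    ring

lemma mul_log_le_sq (l : ℕ) : (l : ℝ) * Real.log l ≤ (l : ℝ) ^ 2 := by
  rw [sq]
  exact mul_le_mul_of_nonneg_left (Real.log_le_self (Nat.cast_nonneg l)) (by positivity)

lemma tendsto_partC : Tendsto partC atTop (nhds Cnat) := by
  have hsq : Summable fun l : ℕ => (l : ℝ) ^ 2 * (1 / 2 : ℝ) ^ l :=
    summable_pow_mul_geometric_of_norm_lt_one 2 (by norm_num)
  have hnn : ∀ l : ℕ, 0 ≤ (l : ℝ) * Real.log l := fun l =>
    mul_nonneg (by positivity) (Real.log_natCast_nonneg l)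
  have hs : Summable fun l : ℕ => (1 / 2 : ℝ) ^ (l + 1) * (l * Real.log l) := by
    refine Summable.of_nonneg_of_le (fun l => mul_nonneg (by positivity) (hnn l)) (fun l => ?_) hsq
    have := mul_log_le_sq l
    have h2 := hnn l
    rw [pow_succ, mul_comm]
    have : (0 : ℝ) < (1 / 2 : ℝ) ^ l := by positivity
    nlinarith
  have hC : ∑' l : ℕ, (1 / 2 : ℝ) ^ (l + 1) * (l * Real.log l) = Cnat := by
    rw [Cnat, Cconst, ← tsum_mul_right]
    refine tsum_congr fun l => ?_
    have : (2 : ℝ) ^ (-(l : ℝ) - 1) = (1 / 2 : ℝ) ^ (l + 1) := by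
      rw [show -(l : ℝ) - 1 = -((l + 1 : ℕ) : ℝ) by push_cast; ring, Real.rpow_neg (by norm_num),
        Real.rpow_natCast, one_div, inv_pow]
    rw [this, Real.logb]
    have := Real.log_pos (show (1 : ℝ) < 2 by norm_num)
    field_simp
  have h1 := (hs.hasSum.tendsto_sum_nat).comp (tendsto_add_atTop_nat 1)
  rw [hC] at h1
  have hz := hsq.tendsto_atTop_zero
  have hz1 := hz.comp (tendsto_add_atTop_nat 1)
  have hb1 : Tendsto (fun h : ℕ => (1 / 2 : ℝ) ^ h * (((h : ℝ) + 1) * Real.log (h + 1))) atTop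
      (nhds 0) := by
    refine squeeze_zero (fun h => ?_) (fun h => ?_) 
      (by simpa only [mul_zero] using hz1.const_mul 2)
    · have := hnn (h + 1); push_cast at this; positivity
    · have := mul_log_le_sq (h + 1)
      push_cast at this
      simp only [Function.comp_apply, pow_succ (1 / 2 : ℝ) h]
      push_cast
      have h0 : (0 : ℝ) < (1 / 2 : ℝ) ^ h := by positivity
      nlinarith
  have hb2 : Tendsto (fun h : ℕ => (1 / 2 : ℝ) ^ (h + 1) * ((h : ℝ) * Real.log h)) atTop
      (nhds 0) := hs.tendsto_atTop_zero
  have := h1.add (hb1.sub hb2)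
  simp only [sub_zero, add_zero] at this
  exact this.congr fun h => by rw [partC_eq h]; rfl

lemma partC_le_Cnat (h : ℕ) : partC h ≤ Cnat := partC_mono.ge_of_tendsto tendsto_partC h

lemma Cnat_le_partC (h : ℕ) : Cnat ≤ partC h + 2 * (1 / 2 : ℝ) ^ h := by
  refine le_of_tendsto tendsto_partC (eventually_atTop.2 ⟨h, fun k hk => ?_⟩)
  have := partC_add_antitone hk
  have h0 : (0 : ℝ) ≤ 2 * (1 / 2 : ℝ) ^ k := by positivity
  simp only at this
  linarith

lemma Cnat_nonneg : 0 ≤ Cnat := by simpa [partC] using partC_le_Cnat 0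

lemma Cnat_le_two : Cnat ≤ 2 := by simpa [partC] using Cnat_le_partC 0

/-! ### Sums over binary words -/

lemma sum_ofFn_cons (n : ℕ) (F : List Bool → ℝ) :
    ∑ x : Fin (n + 1) → Bool, F (List.ofFn x) =
      ∑ a : Bool, ∑ x : Fin n → Bool, F (a :: List.ofFn x) := by
  rw [← (Fin.consEquiv fun _ : Fin (n + 1) => Bool).sum_comp, Fintype.sum_prod_type]
  simp [Fin.consEquiv, List.ofFn_succ]

lemma sum_ofFn_concat (n : ℕ) (F : List Bool → ℝ) :
    ∑ x : Fin (n + 1) → Bool, F (List.ofFn x) =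
      ∑ a : Bool, ∑ x : Fin n → Bool, F (List.ofFn x ++ [a]) := by
  rw [← (Fin.snocEquiv fun _ : Fin (n + 1) => Bool).sum_comp, Fintype.sum_prod_type]
  simp only [Fin.snocEquiv, Equiv.coe_fn_mk, List.ofFn_succ_last, Fin.snoc_castSucc, Fin.snoc_last]

/-- The average of `F` over all binary words of length `n`. -/
def avg (n : ℕ) (F : List Bool → ℝ) : ℝ := (1 / 2 : ℝ) ^ n * ∑ x : Fin n → Bool, F (List.ofFn x)

@[simp] lemma avg_zero (F : List Bool → ℝ) : avg 0 F = F [] := by simp [avg]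

lemma avg_cons (n : ℕ) (F : List Bool → ℝ) :
    avg (n + 1) F = (1 / 2) * ∑ a : Bool, avg n (fun x => F (a :: x)) := by
  simp only [avg, sum_ofFn_cons, ← Finset.mul_sum, pow_succ]
  ring

lemma avg_concat (n : ℕ) (F : List Bool → ℝ) :
    avg (n + 1) F = (1 / 2) * ∑ a : Bool, avg n (fun x => F (x ++ [a])) := by
  simp only [avg, sum_ofFn_concat, ← Finset.mul_sum, pow_succ]
  ring

lemma avg_mono {n : ℕ} {F G : List Bool → ℝ} (h : ∀ x, x.length = n → F x ≤ G x) :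
    avg n F ≤ avg n G :=
  mul_le_mul_of_nonneg_left (Finset.sum_le_sum fun x _ => h _ (by simp)) (by positivity)

lemma avg_congr {n : ℕ} {F G : List Bool → ℝ} (h : ∀ x, x.length = n → F x = G x) :
    avg n F = avg n G :=
  le_antisymm (avg_mono fun x hx => (h x hx).le) (avg_mono fun x hx => (h x hx).ge)

lemma avg_add (n : ℕ) (F G : List Bool → ℝ) :
    avg n (fun x => F x + G x) = avg n F + avg n G := by
  simp only [avg, Finset.sum_add_distrib, mul_add]

lemma avg_sub (n : ℕ) (F G : List Bool → ℝ) :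
    avg n (fun x => F x - G x) = avg n F - avg n G := by
  simp only [avg, Finset.sum_sub_distrib, mul_sub]

lemma avg_const_mul (n : ℕ) (c : ℝ) (F : List Bool → ℝ) :
    avg n (fun x => c * F x) = c * avg n F := by
  simp only [avg, ← Finset.mul_sum]
  ring

lemma avg_sum {ι : Type*} (n : ℕ) (s : Finset ι) (F : ι → List Bool → ℝ) :
    avg n (fun x => ∑ i ∈ s, F i x) = ∑ i ∈ s, avg n (F i) := by
  simp only [avg, ← Finset.mul_sum]
  rw [Finset.sum_comm]

@[simp] lemma avg_const (n : ℕ) (c : ℝ) : avg n (fun _ => c) = c := by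
  simp only [avg, Finset.sum_const, Finset.card_univ, Fintype.card_fun, Fintype.card_bool,
    Fintype.card_fin, nsmul_eq_mul, Nat.cast_pow, Nat.cast_ofNat]
  rw [← mul_assoc, ← mul_pow]
  norm_num

/-- The binary words of length at most `n`. -/
def shortWords (n : ℕ) : Finset (List Bool) := (List.finite_length_le Bool n).toFinset

@[simp] lemma mem_shortWords {n : ℕ} {y : List Bool} : y ∈ shortWords n ↔ y.length ≤ n := by
  simp [shortWords]

@[simp] lemma shortWords_zero : shortWords 0 = {[]} := by
  ext y; simp

lemma sum_shortWords_succ (n : ℕ) (F : List Bool → ℝ) :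
    ∑ y ∈ shortWords (n + 1), F y = F [] + ∑ a : Bool, ∑ y ∈ shortWords n, F (a :: y) := by
  have h : shortWords (n + 1) = insert [] ((Finset.univ ×ˢ shortWords n).image
      fun p : Bool × List Bool => p.1 :: p.2) := by
    ext y
    cases y <;> simp
  rw [h, Finset.sum_insert (by simp), Finset.sum_image, Finset.sum_product]
  rintro ⟨a, y⟩ _ ⟨b, z⟩ _ h
  simpa using h

lemma sum_shortWords_of_vanish (n : ℕ) (F : List Bool → ℝ) (hF : ∀ y, y.length = n + 1 → F y = 0) :
    ∑ y ∈ shortWords (n + 1), F y = ∑ y ∈ shortWords n, F y := by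
  symm
  refine Finset.sum_subset (fun y hy => ?_) fun y hy hy' => hF y ?_
  · simp only [mem_shortWords] at *; omega
  · simp only [mem_shortWords] at *; omega

/-- Reads off the symbol `a` at the front of `y` and evaluates `g` on the rest;
zero if `y` does not begin with `a`. -/
def front (a : Bool) (g : List Bool → ℝ) : List Bool → ℝ
  | [] => 0
  | c :: y => if c = a then g y else 0

/-- Reads off the symbol `a` at the end of `y` and evaluates `g` on the rest;
zero if `y` does not end with `a`. -/
def back (a : Bool) (g : List Bool → ℝ) (y : List Bool) : ℝ :=
  if y.getLast? = some a then g y.dropLast else 0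

@[simp] lemma front_cons_self (a : Bool) (g : List Bool → ℝ) (y : List Bool) :
    front a g (a :: y) = g y := by simp [front]

lemma back_concat_self (a : Bool) (g : List Bool → ℝ) (y : List Bool) :
    back a g (y ++ [a]) = g y := by simp [back]

lemma front_nonneg {a : Bool} {g : List Bool → ℝ} (h : ∀ y, 0 ≤ g y) (y : List Bool) :
    0 ≤ front a g y := by
  unfold front; split
  · exact le_rfl
  · split_ifs
    exacts [h _, le_rfl]

lemma sum_front (n : ℕ) (a : Bool) (φ : List Bool → ℝ → ℝ) (hφ : ∀ y, φ y 0 = 0)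
    (g : List Bool → ℝ) :
    ∑ y ∈ shortWords (n + 1), φ y (front a g y) = ∑ y ∈ shortWords n, φ (a :: y) (g y) := by
  rw [sum_shortWords_succ]
  cases a <;> simp [front, hφ]

lemma sum_concat_le (n : ℕ) (a : Bool) (F : List Bool → ℝ) (hF : ∀ y, 0 ≤ F y) :
    ∑ y ∈ shortWords n, F (y ++ [a]) ≤ ∑ y ∈ shortWords (n + 1), F y := by
  have h : ∑ y ∈ shortWords n, F (y ++ [a]) = ∑ y ∈ (shortWords n).image (· ++ [a]), F y := by
    rw [Finset.sum_image]
    intro y _ z _ h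
    simpa using h
  rw [h]
  refine Finset.sum_le_sum_of_subset_of_nonneg (fun y hy => ?_) fun y _ _ => hF y
  obtain ⟨z, hz, rfl⟩ := Finset.mem_image.1 hy
  simpa using hz

/-! ### The likelihood of an output word -/

section Chain

variable (α β : ℝ)

/-- Probability that the word `x` is turned into `y` and that the deletion pattern is in state `t`
just after `x`, given that it is in state `s` just before `x`. -/
def lik : List Bool → List Bool → Bool → Bool → ℝ
  | [], y, s, t => if y = [] then transD α β s t else 0
  | a :: x, y, s, t => transD α β s true * lik x y true t +
      transD α β s false * front a (fun z => lik x z false t) y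

lemma lik_cons (a : Bool) (x y : List Bool) (s t : Bool) :
    lik α β (a :: x) y s t = transD α β s true * lik α β x y true t +
      transD α β s false * front a (fun z => lik α β x z false t) y := rfl

lemma sum_transD (s : Bool) : ∑ t : Bool, transD α β s t = 1 := by
  cases s <;> simp [transD]

lemma lik_eq_zero_of_lt : ∀ (x y : List Bool) (s t : Bool), x.length < y.length →
    lik α β x y s t = 0
  | [], y, s, t, h => by
    have : y ≠ [] := by rintro rfl; simp at h
    simp [lik, this]
  | a :: x, y, s, t, h => by
    rw [lik_cons, lik_eq_zero_of_lt x y true t (by simp at h; omega)]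
    cases y with
    | nil => simp at h
    | cons c y =>
      simp only [front]
      rw [lik_eq_zero_of_lt x y false t (by simpa using h)]
      simp

/-- Summation of a function of the output against the likelihood, as an iterated expectation over
the states of the deletion pattern. -/
def chainExp : ℕ → Bool → (List Bool → ℝ) → ℝ
  | 0, _, F => F []
  | n + 1, s, F => ∑ b : Bool, transD α β s b * chainExp n b (fun d => F (b :: d))

@[simp] lemma yList_nil (d : List Bool) : yList [] d = [] := by simp [yList]

@[simp] lemma yList_cons_true (a : Bool) (x d : List Bool) :
    yList (a :: x) (true :: d) = yList x d := by simp [yList]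

@[simp] lemma yList_cons_false (a : Bool) (x d : List Bool) :
    yList (a :: x) (false :: d) = a :: yList x d := by simp [yList]

lemma sum_lik_mul : ∀ (x : List Bool) (s : Bool) (F : List Bool → ℝ),
    ∑ t : Bool, ∑ y ∈ shortWords x.length, lik α β x y s t * F y =
      chainExp α β x.length s (fun d => F (yList x d))
  | [], s, F => by
    simp only [List.length_nil, shortWords_zero, Finset.sum_singleton, lik, if_true, chainExp,
      ← Finset.sum_mul, sum_transD, yList_nil, one_mul]
  | a :: x, s, F => by
    simp only [List.length_cons, chainExp, Fintype.sum_bool (fun b => transD α β s b * _),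
      yList_cons_true, yList_cons_false]
    rw [← sum_lik_mul x true, ← sum_lik_mul x false (fun y => F (a :: y))]
    simp only [Finset.mul_sum, ← Finset.sum_add_distrib]
    refine Finset.sum_congr rfl fun t _ => ?_
    simp only [lik_cons, add_mul, Finset.sum_add_distrib]
    congr 1
    · rw [sum_shortWords_of_vanish]
      · simp only [mul_assoc]
      · intro y hy
        rw [lik_eq_zero_of_lt α β x y true t (by omega)]; simp
    · rw [sum_front x.length a (fun y v => transD α β s false * v * F y) (by simp)]
      simp only [mul_assoc]

lemma chainExp_const (n : ℕ) (s : Bool) (c : ℝ) : chainExp α β n s (fun _ => c) = c := by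
  induction n generalizing s with
  | zero => rfl
  | succ n ih => simp only [chainExp, ih, ← Finset.sum_mul, sum_transD, one_mul]

lemma sum_lik (x : List Bool) (s : Bool) :
    ∑ t : Bool, ∑ y ∈ shortWords x.length, lik α β x y s t = 1 := by
  have := sum_lik_mul α β x s (fun _ => 1)
  simpa [chainExp_const] using this

variable {α β}

lemma transD_nonneg (hα : 0 < α ∧ α < 1) (hβ : 0 < β ∧ β < 1) (s t : Bool) :
    0 ≤ transD α β s t := by
  cases s <;> cases t <;> simp [transD] <;> linarith

lemma initD_nonneg (hα : 0 < α ∧ α < 1) (hβ : 0 < β ∧ β < 1) (s : Bool) :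
    0 ≤ initD α β s := by
  have := hα.1
  have := hβ.1
  cases s <;> simp only [initD] <;> simp <;> positivity

lemma sum_initD (hα : 0 < α ∧ α < 1) (hβ : 0 < β ∧ β < 1) : ∑ s : Bool, initD α β s = 1 := by
  have : α + β ≠ 0 := by linarith
  simp [initD]
  field_simp
  ring

lemma sum_initD_mul_transD (hα : 0 < α ∧ α < 1) (hβ : 0 < β ∧ β < 1) (t : Bool) :
    ∑ s : Bool, initD α β s * transD α β s t = initD α β t := by
  have : α + β ≠ 0 := by linarith
  cases t <;> simp [initD, transD] <;> field_simp <;> ring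

lemma lik_nonneg (hα : 0 < α ∧ α < 1) (hβ : 0 < β ∧ β < 1) :
    ∀ (x y : List Bool) (s t : Bool), 0 ≤ lik α β x y s t
  | [], y, s, t => by
    simp only [lik]
    split_ifs
    exacts [transD_nonneg hα hβ s t, le_rfl]
  | a :: x, y, s, t => by
    have h1 := transD_nonneg hα hβ s true
    have h2 := transD_nonneg hα hβ s false
    have h3 := lik_nonneg hα hβ x y true t
    have h4 := front_nonneg (a := a) (fun z => lik_nonneg hα hβ x z false t) y
    rw [lik_cons]
    positivity

lemma front_add (a : Bool) (g h : List Bool → ℝ) (y : List Bool) :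
    front a (fun z => g z + h z) y = front a g y + front a h y := by
  cases y with
  | nil => simp [front]
  | cons c y => simp only [front]; split_ifs <;> simp

lemma front_mul (a : Bool) (c : ℝ) (g : List Bool → ℝ) (y : List Bool) :
    front a (fun z => c * g z) y = c * front a g y := by
  cases y with
  | nil => simp [front]
  | cons c y => simp only [front]; split_ifs <;> simp
end Chain

/-! ### Chain rule for the output entropy -/

section ChainRule

variable (α β : ℝ)

/-- Entropy (in nats) of the output and the final state, given the input `x` and the initial
state `s`. -/
def outEnt (x : List Bool) (s : Bool) : ℝ :=
  ∑ t : Bool, ∑ y ∈ shortWords x.length, Real.negMulLog (lik α β x y s t)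

/-- Entropy (in nats) of the first deletion indicator, given the output, the input `x`, the initial
state `s` and the final state. -/
def posEnt : List Bool → Bool → ℝ
  | [], _ => 0
  | a :: x, s => ∑ t : Bool, ∑ y ∈ shortWords (x.length + 1),
      eta (transD α β s true * lik α β x y true t)
        (transD α β s false * front a (fun z => lik α β x z false t) y)

/-- `posEnt` averaged over inputs of length `n + 1` and the stationary initial state. -/
def posEntAvg (n : ℕ) : ℝ := avg (n + 1) fun x => ∑ s : Bool, initD α β s * posEnt α β x s

/-- `outEnt` averaged over inputs of length `n` and the stationary initial state. -/
def outEntAvg (n : ℕ) : ℝ := avg n fun x => ∑ s : Bool, initD α β s * outEnt α β x s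

/-- Entropy rate (in nats) of the deletion pattern. -/
def chainRate : ℝ := ∑ s : Bool, initD α β s * ∑ b : Bool, Real.negMulLog (transD α β s b)

lemma outEnt_cons (a : Bool) (x : List Bool) (s : Bool) :
    outEnt α β (a :: x) s = ∑ b : Bool, Real.negMulLog (transD α β s b) +
      ∑ b : Bool, transD α β s b * outEnt α β x b - posEnt α β (a :: x) s := by
  have h1 : ∀ t, ∑ y ∈ shortWords (x.length + 1),
      Real.negMulLog (transD α β s true * lik α β x y true t) =
      Real.negMulLog (transD α β s true) * ∑ y ∈ shortWords x.length, lik α β x y true t +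
        transD α β s true * ∑ y ∈ shortWords x.length, Real.negMulLog (lik α β x y true t) := by
    intro t
    rw [sum_shortWords_of_vanish, Finset.mul_sum, Finset.mul_sum, ← Finset.sum_add_distrib]
    · exact Finset.sum_congr rfl fun y _ => by rw [Real.negMulLog_mul]; ring
    · intro y hy
      rw [lik_eq_zero_of_lt α β x y true t (by omega)]; simp
  have h2 : ∀ t, ∑ y ∈ shortWords (x.length + 1),
      Real.negMulLog (transD α β s false * front a (fun z => lik α β x z false t) y) =
      Real.negMulLog (transD α β s false) * ∑ y ∈ shortWords x.length, lik α β x y false t +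
        transD α β s false * ∑ y ∈ shortWords x.length, Real.negMulLog (lik α β x y false t) := by
    intro t
    rw [sum_front x.length a (fun _ v => Real.negMulLog (transD α β s false * v)) (by simp),
      Finset.mul_sum, Finset.mul_sum, ← Finset.sum_add_distrib]
    exact Finset.sum_congr rfl fun y _ => by rw [Real.negMulLog_mul]; ring
  have h3 : outEnt α β (a :: x) s + posEnt α β (a :: x) s =
      ∑ t : Bool, (∑ y ∈ shortWords (x.length + 1),
        Real.negMulLog (transD α β s true * lik α β x y true t) +
      ∑ y ∈ shortWords (x.length + 1),
        Real.negMulLog (transD α β s false * front a (fun z => lik α β x z false t) y)) := by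
    simp only [outEnt, posEnt, lik_cons, List.length_cons, ← Finset.sum_add_distrib, eta]
    exact Finset.sum_congr rfl fun t _ => Finset.sum_congr rfl fun y _ => by ring
  have e1 := sum_lik α β x true
  have e2 := sum_lik α β x false
  rw [eq_sub_iff_add_eq, h3]
  simp only [h1, h2, Finset.sum_add_distrib, ← Finset.mul_sum, e1, e2, Fintype.sum_bool, outEnt]
  ring

variable {α β}

lemma outEntAvg_succ (hα : 0 < α ∧ α < 1) (hβ : 0 < β ∧ β < 1) (n : ℕ) :
    outEntAvg α β (n + 1) = outEntAvg α β n + chainRate α β - posEntAvg α β n := by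
  have hπ : ∀ x, ∑ s : Bool, initD α β s * ∑ b : Bool, transD α β s b * outEnt α β x b =
      ∑ b : Bool, initD α β b * outEnt α β x b := by
    intro x
    simp only [Finset.mul_sum]
    rw [Finset.sum_comm]
    refine Finset.sum_congr rfl fun b _ => ?_
    rw [← sum_initD_mul_transD hα hβ b, Finset.sum_mul]
    simp only [mul_assoc]
  have h : ∀ a x, ∑ s : Bool, initD α β s * outEnt α β (a :: x) s = chainRate α β +
      ∑ b : Bool, initD α β b * outEnt α β x b -
      ∑ s : Bool, initD α β s * posEnt α β (a :: x) s := by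
    intro a x
    rw [chainRate, ← hπ x, ← Finset.sum_add_distrib, ← Finset.sum_sub_distrib]
    exact Finset.sum_congr rfl fun s _ => by rw [outEnt_cons]; ring
  simp only [outEntAvg, posEntAvg, avg_cons, h, avg_sub, avg_add, avg_const,
    Finset.sum_sub_distrib (s := (Finset.univ : Finset Bool)), Finset.sum_const, Finset.card_univ,
    Fintype.card_bool, nsmul_eq_mul]
  push_cast
  ring

lemma outEntAvg_eq (hα : 0 < α ∧ α < 1) (hβ : 0 < β ∧ β < 1) (n : ℕ) :
    outEntAvg α β n = outEntAvg α β 0 + n * chainRate α β -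
      ∑ k ∈ Finset.range n, posEntAvg α β k := by
  induction n with
  | zero => simp
  | succ n ih =>
    rw [outEntAvg_succ hα hβ, ih, Finset.sum_range_succ]
    push_cast
    ring

lemma front_back (a c : Bool) (g : List Bool → ℝ) (y : List Bool) :
    front a (back c g) y = back c (front a g) y := by
  rcases y with _ | ⟨e, _ | ⟨e', y⟩⟩
  · simp [front, back]
  · simp [front, back]
  · simp only [front, back, List.getLast?_cons_cons, List.dropLast_cons_cons]
    split_ifs <;> rfl

lemma back_add (a : Bool) (g h : List Bool → ℝ) (y : List Bool) :
    back a (fun z => g z + h z) y = back a g y + back a h y := by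
  simp only [back]; split_ifs <;> simp

lemma back_mul (a : Bool) (c : ℝ) (g : List Bool → ℝ) (y : List Bool) :
    back a (fun z => c * g z) y = c * back a g y := by
  simp only [back]; split_ifs <;> simp

lemma back_nonneg {a : Bool} {g : List Bool → ℝ} (h : ∀ y, 0 ≤ g y) (y : List Bool) :
    0 ≤ back a g y := by
  unfold back; split_ifs
  exacts [h _, le_rfl]

variable (α β) in
lemma lik_concat (c : Bool) : ∀ (x y : List Bool) (s t : Bool),
    lik α β (x ++ [c]) y s t = transD α β true t * lik α β x y s true +
      transD α β false t * back c (fun z => lik α β x z s false) y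
  | [], y, s, t => by
    rcases y with _ | ⟨e, _ | ⟨e', y⟩⟩
    · simp [lik, front, back, mul_comm]
    · simp [lik, front, back, mul_comm]
    · simp [lik, front, back]
  | a :: x, y, s, t => by
    rw [List.cons_append, lik_cons, lik_concat c x y true t]
    simp only [lik_concat c x _ false t, front_add, front_mul, lik_cons, back_add, back_mul]
    rw [← front_back]
    simp only [back]
    ring

lemma posEnt_le_concat (hα : 0 < α ∧ α < 1) (hβ : 0 < β ∧ β < 1) (a c : Bool) (x : List Bool)
    (s : Bool) : posEnt α β (a :: x) s ≤ posEnt α β (a :: x ++ [c]) s := by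
  have hl := lik_nonneg hα hβ
  have hT := transD_nonneg hα hβ
  have hterm : ∀ (u y), 0 ≤ eta (transD α β s true * lik α β x y true u)
        (transD α β s false * front a (fun z => lik α β x z false u) y) := fun u y =>
    eta_nonneg (mul_nonneg (hT _ _) (hl _ _ _ _))
      (mul_nonneg (hT _ _) (front_nonneg (fun z => hl _ _ _ _) y))
  set E : Bool → List Bool → ℝ := fun u y => eta (transD α β s true * lik α β x y true u)
        (transD α β s false * front a (fun z => lik α β x z false u) y) with hE
  have key : ∀ t y, transD α β true t * E true y + transD α β false t * back c (E false) y ≤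
      eta (transD α β s true * lik α β (x ++ [c]) y true t)
        (transD α β s false * front a (fun z => lik α β (x ++ [c]) z false t) y) := by
    intro t y
    simp only [lik_concat, front_add, front_mul]
    have hb : back c (E false) y = eta
        (transD α β s true * back c (fun z => lik α β x z true false) y)
        (transD α β s false * front a (back c (fun z => lik α β x z false false)) y) := by
      rw [front_back]
      simp only [back, hE]
      split_ifs <;> simp
    have hfb : front a (fun z => back c (fun z => lik α β x z false false) z) y =
      front a (back c (fun z => lik α β x z false false)) y := rfl
    rw [hb, ← eta_mul, ← eta_mul, hfb]
    refine (eta_add_le ?_ ?_ ?_ ?_).trans_eq (by congr 1 <;> ring)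
    · exact mul_nonneg (hT _ _) (mul_nonneg (hT _ _) (hl _ _ _ _))
    · exact mul_nonneg (hT _ _) (mul_nonneg (hT _ _) (front_nonneg (fun z => hl _ _ _ _) y))
    · exact mul_nonneg (hT _ _) (mul_nonneg (hT _ _) (back_nonneg (fun z => hl _ _ _ _) y))
    · exact mul_nonneg (hT _ _) (mul_nonneg (hT _ _)
        (front_nonneg (back_nonneg fun z => hl _ _ _ _) y))
  have htr : ∑ y ∈ shortWords (x.length + 1), E true y ≤
      ∑ y ∈ shortWords (x.length + 1 + 1), E true y :=
    Finset.sum_le_sum_of_subset_of_nonneg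
      (fun y hy => by simp only [mem_shortWords] at *; omega) fun y _ _ => hterm true y
  have hfa : ∑ y ∈ shortWords (x.length + 1), E false y ≤
      ∑ y ∈ shortWords (x.length + 1 + 1), back c (E false) y := by
    refine le_trans (le_of_eq ?_) (sum_concat_le (x.length + 1) c (back c (E false))
      (back_nonneg (hterm false)))
    simp only [back_concat_self]
  calc posEnt α β (a :: x) s = ∑ u, ∑ y ∈ shortWords (x.length + 1), E u y := rfl
    _ ≤ ∑ y ∈ shortWords (x.length + 1 + 1), E true y +
        ∑ y ∈ shortWords (x.length + 1 + 1), back c (E false) y := by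
      rw [Fintype.sum_bool]; exact add_le_add htr hfa
    _ = ∑ t, ∑ y ∈ shortWords (x.length + 1 + 1),
        (transD α β true t * E true y + transD α β false t * back c (E false) y) := by
      simp only [Finset.sum_add_distrib, ← Finset.mul_sum, ← Finset.sum_mul, sum_transD, one_mul]
    _ ≤ _ := by
      rw [List.cons_append]
      simp only [posEnt, List.length_append, List.length_singleton]
      exact Finset.sum_le_sum fun t _ => Finset.sum_le_sum fun y _ => key t y

lemma posEntAvg_mono (hα : 0 < α ∧ α < 1) (hβ : 0 < β ∧ β < 1) : Monotone (posEntAvg α β) := by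
  refine monotone_nat_of_le_succ fun n => ?_
  rw [posEntAvg, posEntAvg, avg_concat (n + 1)]
  have h : ∀ c, avg (n + 1) (fun x => ∑ s : Bool, initD α β s * posEnt α β x s) ≤
      avg (n + 1) (fun x => ∑ s : Bool, initD α β s * posEnt α β (x ++ [c]) s) := by
    intro c
    refine avg_mono fun x hx => Finset.sum_le_sum fun s _ => ?_
    cases x with
    | nil => simp at hx
    | cons a x =>
      exact mul_le_mul_of_nonneg_left (posEnt_le_concat hα hβ a c x s) (initD_nonneg hα hβ s)
  rw [Fintype.sum_bool]
  linarith [h true, h false]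

lemma posEnt_nonneg (hα : 0 < α ∧ α < 1) (hβ : 0 < β ∧ β < 1) (x : List Bool) (s : Bool) :
    0 ≤ posEnt α β x s := by
  cases x with
  | nil => simp [posEnt]
  | cons a x =>
    refine Finset.sum_nonneg fun t _ => Finset.sum_nonneg fun y _ => eta_nonneg ?_ ?_
    · exact mul_nonneg (transD_nonneg hα hβ _ _) (lik_nonneg hα hβ _ _ _ _)
    · exact mul_nonneg (transD_nonneg hα hβ _ _)
        (front_nonneg (fun z => lik_nonneg hα hβ _ _ _ _) y)

/-- Cross-entropy bound for `posEnt`: `q x y` is an arbitrary guess at the probability that the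
first symbol of `x` has been deleted. -/
lemma posEnt_le_chainExp (hα : 0 < α ∧ α < 1) (hβ : 0 < β ∧ β < 1) {n : ℕ} (x : List Bool)
    (hx : x.length = n + 1) (s : Bool) (q : List Bool → ℝ) (hq : ∀ y, 0 < q y ∧ q y < 1) :
    posEnt α β x s ≤ chainExp α β (n + 1) s (fun d =>
      if d.head? = some true then -Real.log (q (yList x d)) else
        -Real.log (1 - q (yList x d))) := by
  cases x with
  | nil => simp at hx
  | cons a x =>
    obtain rfl : x.length = n := by simpa using hx
    simp only [chainExp, posEnt, Fintype.sum_bool (fun b => transD α β s b * _),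
      List.head?_cons, Option.some.injEq, if_true, if_false, Bool.false_eq_true,
      yList_cons_true, yList_cons_false]
    rw [← sum_lik_mul α β x true (fun y => -Real.log (q y)),
      ← sum_lik_mul α β x false (fun y => -Real.log (1 - q (a :: y)))]
    simp only [Finset.mul_sum (s := (Finset.univ : Finset Bool)), ← Finset.sum_add_distrib]
    refine Finset.sum_le_sum fun t _ => ?_
    refine (Finset.sum_le_sum fun y _ => eta_le_cross (q := q y) (q' := 1 - q y) ?_ ?_ (hq y).1
      (by linarith [(hq y).2]) (by ring)).trans_eq ?_
    · exact mul_nonneg (transD_nonneg hα hβ _ _) (lik_nonneg hα hβ _ _ _ _)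
    · exact mul_nonneg (transD_nonneg hα hβ _ _)
        (front_nonneg (fun z => lik_nonneg hα hβ _ _ _ _) y)
    · rw [Finset.sum_add_distrib, sum_shortWords_of_vanish,
        sum_front x.length a (fun y v => transD α β s false * v * -Real.log (1 - q y)) (by simp)]
      · simp only [Finset.mul_sum, mul_assoc]
      · intro y hy
        rw [lik_eq_zero_of_lt α β x y true t (by omega)]; simp

lemma posEnt_le_log_two (hα : 0 < α ∧ α < 1) (hβ : 0 < β ∧ β < 1) {n : ℕ} (x : List Bool)
    (hx : x.length = n + 1) (s : Bool) : posEnt α β x s ≤ Real.log 2 := by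
  refine (posEnt_le_chainExp hα hβ x hx s (fun _ => 1 / 2) fun _ => by norm_num).trans_eq ?_
  have : (1 : ℝ) - 1 / 2 = 1 / 2 := by norm_num
  simp only [this, ite_self, chainExp_const]
  simp

lemma posEntAvg_le_log_two (hα : 0 < α ∧ α < 1) (hβ : 0 < β ∧ β < 1) (n : ℕ) :
    posEntAvg α β n ≤ Real.log 2 := by
  refine (avg_mono fun x hx => ?_).trans_eq (avg_const (n + 1) (Real.log 2))
  calc _ ≤ ∑ s : Bool, initD α β s * Real.log 2 := Finset.sum_le_sum fun s _ =>
        mul_le_mul_of_nonneg_left (posEnt_le_log_two hα hβ x hx s) (initD_nonneg hα hβ s)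
    _ = _ := by rw [← Finset.sum_mul, sum_initD hα hβ, one_mul]

/-- The limit of `posEntAvg`. -/
def posEntLim (α β : ℝ) : ℝ := ⨆ n, posEntAvg α β n

lemma bddAbove_posEntAvg (hα : 0 < α ∧ α < 1) (hβ : 0 < β ∧ β < 1) :
    BddAbove (Set.range (posEntAvg α β)) :=
  ⟨Real.log 2, by rintro _ ⟨n, rfl⟩; exact posEntAvg_le_log_two hα hβ n⟩

lemma tendsto_posEntAvg (hα : 0 < α ∧ α < 1) (hβ : 0 < β ∧ β < 1) :
    Tendsto (posEntAvg α β) atTop (nhds (posEntLim α β)) :=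
  tendsto_atTop_ciSup (posEntAvg_mono hα hβ) (bddAbove_posEntAvg hα hβ)

lemma tendsto_outEntAvg_div (hα : 0 < α ∧ α < 1) (hβ : 0 < β ∧ β < 1) :
    Tendsto (fun n : ℕ => outEntAvg α β n / n) atTop (nhds (chainRate α β - posEntLim α β)) := by
  have h1 := (tendsto_posEntAvg hα hβ).cesaro
  have h2 : Tendsto (fun n : ℕ => outEntAvg α β 0 / n) atTop (nhds 0) :=
    tendsto_const_div_atTop_nhds_zero_nat _
  have h3 := (h2.add_const (chainRate α β)).sub h1
  rw [zero_add] at h3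
  refine h3.congr' ((eventually_gt_atTop 0).mono fun n hn => ?_)
  have : (n : ℝ) ≠ 0 := by exact_mod_cast hn.ne'
  simp only [outEntAvg_eq hα hβ n]
  field_simp

end ChainRule

/-! ### Entropies of the model in terms of the likelihood -/

section Model

variable {Ω A B : Type} [Fintype Ω]

lemma prob_eq_sum_ite (p : Ω → ℝ) (E : Ω → Prop) : prob p E = ∑ ω, if E ω then p ω else 0 := by
  rw [prob, Finset.sum_filter]

lemma prob_eq_sum_fiber (p : Ω → ℝ) (f : Ω → A) (E : Ω → Prop) (S : Finset A)
    (hS : ∀ ω, f ω ∈ S) : prob p E = ∑ a ∈ S, prob p (fun ω => f ω = a ∧ E ω) := by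
  simp only [prob_eq_sum_ite]
  rw [Finset.sum_comm]
  refine Finset.sum_congr rfl fun ω _ => ?_
  rw [Finset.sum_eq_single (f ω)]
  · simp
  · intro a _ ha
    rw [if_neg fun h => ha h.1.symm]
  · exact fun h => absurd (hS ω) h

lemma condEnt_eq_sum (p : Ω → ℝ) (f : Ω → A) (g : Ω → B) (S : Finset A) (T : Finset B)
    (hS : ∀ ω, f ω ∈ S) (hT : ∀ ω, g ω ∈ T) :
    condEnt p f g = -∑ a ∈ S, ∑ b ∈ T, prob p (fun ω => f ω = a ∧ g ω = b) *
      Real.logb 2 (prob p (fun ω => f ω = a ∧ g ω = b) / prob p (fun ω => g ω = b)) := by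
  rw [condEnt, ← Finset.sum_product' (s := S) (t := T)]
  congr 1
  refine Finset.sum_subset_zero_on_sdiff (fun ab hab => ?_) (fun ab hab => ?_) fun ab _ => ?_
  · obtain ⟨ω, -, rfl⟩ := Finset.mem_image.1 hab
    exact Finset.mem_product.2 ⟨hS ω, hT ω⟩
  · have h0 : prob p (fun ω => f ω = ab.1 ∧ g ω = ab.2) = 0 := by
      rw [prob_eq_sum_ite]
      refine Finset.sum_eq_zero fun ω _ => if_neg fun h => (Finset.mem_sdiff.1 hab).2 ?_
      exact Finset.mem_image.2 ⟨ω, Finset.mem_univ _, Prod.ext h.1 h.2⟩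
    rw [h0, zero_mul]
  · split_ifs with h
    · rw [h, zero_mul]
    · rfl

lemma neg_mul_logb_two (v : ℝ) : -(v * Real.logb 2 v) = Real.negMulLog v / Real.log 2 := by
  rw [Real.negMulLog, Real.logb]; ring

variable (α β : ℝ)

/-- Probability of the states `d`, given the preceding state `s`. -/
def pathProb {n : ℕ} (s : Bool) (d : Fin (n + 1) → Bool) : ℝ :=
  transD α β s (d 0) * ∏ i : Fin n, transD α β (d i.castSucc) (d i.succ)

lemma pathProb_cons {n : ℕ} (s b : Bool) (d : Fin (n + 1) → Bool) :
    pathProb α β s (Fin.cons b d : Fin (n + 2) → Bool) =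
      transD α β s b * pathProb α β b d := by
  simp only [pathProb, Fin.prod_univ_succ (n := n), Fin.cons_zero, Fin.castSucc_zero,
    Fin.cons_succ, ← Fin.succ_castSucc]

lemma pMarkov_cons {n : ℕ} (s : Bool) (d : Fin (n + 1) → Bool) :
    pMarkov α β (Fin.cons s d : Fin (n + 2) → Bool) = initD α β s * pathProb α β s d := by
  simp only [pMarkov, pathProb, Fin.prod_univ_succ (n := n), Fin.cons_zero, Fin.castSucc_zero,
    Fin.cons_succ, ← Fin.succ_castSucc]

lemma sum_fin_cons {n : ℕ} (F : (Fin (n + 1) → Bool) → ℝ) :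
    ∑ d, F d = ∑ b : Bool, ∑ d : Fin n → Bool, F (Fin.cons b d) := by
  rw [← (Fin.consEquiv fun _ : Fin (n + 1) => Bool).sum_comp, Fintype.sum_prod_type]
  rfl

lemma sum_pathProb : ∀ {n : ℕ} (x : Fin n → Bool) (y : List Bool) (s t : Bool),
    (∑ d : Fin (n + 1) → Bool, if d (Fin.last n) = t ∧
      yList (List.ofFn x) (List.ofFn fun i : Fin n => d i.castSucc) = y
      then pathProb α β s d else 0) = lik α β (List.ofFn x) y s t
  | 0, x, y, s, t => by
    rw [sum_fin_cons]
    cases y <;> cases t <;> simp [lik, pathProb]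
  | n + 1, x, y, s, t => by
    rw [sum_fin_cons, Fintype.sum_bool, List.ofFn_succ, lik_cons,
      ← sum_pathProb (fun i => x i.succ) y true t]
    simp only [pathProb_cons, ← Fin.succ_last, Fin.cons_succ, List.ofFn_succ (n := n),
      Fin.castSucc_zero, Fin.cons_zero, yList_cons_true, yList_cons_false, ← Fin.succ_castSucc]
    congr 1
    · rw [Finset.mul_sum]
      exact Finset.sum_congr rfl fun d _ => by split_ifs <;> simp
    · cases y with
      | nil => simp [front]
      | cons c y =>
        simp only [front, List.cons.injEq]
        split_ifs with h
        · rw [← sum_pathProb (fun i => x i.succ) y false t, Finset.mul_sum]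
          refine Finset.sum_congr rfl fun d _ => ?_
          simp only [h, true_and]
          split_ifs <;> simp
        · rw [mul_zero]
          exact Finset.sum_eq_zero fun d _ => if_neg fun h' => h h'.2.1.symm

/-- Probability of the output `y` given the input `x`. -/
def outProb (x y : List Bool) : ℝ := ∑ s : Bool, initD α β s * ∑ t : Bool, lik α β x y s t

lemma sum_pMarkov {n : ℕ} (x : Fin n → Bool) (y : List Bool) :
    (∑ dp : Fin (n + 2) → Bool, if yOut (x, dp) = y then pMarkov α β dp else 0) =
      outProb α β (List.ofFn x) y := by
  rw [sum_fin_cons, outProb]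
  refine Finset.sum_congr rfl fun s _ => ?_
  simp only [← sum_pathProb]
  rw [Finset.sum_comm, Finset.mul_sum]
  refine Finset.sum_congr rfl fun d _ => ?_
  have hy : yOut (x, (Fin.cons s d : Fin (n + 2) → Bool)) =
      yList (List.ofFn x) (List.ofFn fun i : Fin n => d i.castSucc) := rfl
  rw [pMarkov_cons, hy]
  simp only [ite_and]
  rw [Finset.sum_ite_eq]
  simp

lemma prob_yOut_and (n : ℕ) (x : Fin n → Bool) (y : List Bool) :
    prob (pJoint α β n) (fun ω => yOut ω = y ∧ ω.1 = x) =
      (1 / 2 : ℝ) ^ n * outProb α β (List.ofFn x) y := by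
  rw [prob_eq_sum_ite, Fintype.sum_prod_type, Finset.sum_eq_single x]
  · rw [← sum_pMarkov, Finset.mul_sum]
    refine Finset.sum_congr rfl fun dp _ => ?_
    simp only [and_true, pJoint]
    split_ifs <;> simp
  · intro x' _ hx'
    exact Finset.sum_eq_zero fun dp _ => if_neg fun h => hx' h.2
  · simp

lemma yList_length_le : ∀ x d : List Bool, (yList x d).length ≤ x.length := by
  intro x d
  simp only [yList, List.length_map]
  refine (List.length_filter_le _ _).trans ?_
  simp

lemma yOut_mem {n : ℕ} (ω : (Fin n → Bool) × (Fin (n + 2) → Bool)) :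
    yOut ω ∈ shortWords n := by
  rw [mem_shortWords, yOut]
  refine (yList_length_le _ _).trans ?_
  simp

variable {α β}

lemma sum_outProb (hα : 0 < α ∧ α < 1) (hβ : 0 < β ∧ β < 1) (x : List Bool) :
    ∑ y ∈ shortWords x.length, outProb α β x y = 1 := by
  simp only [outProb]
  rw [Finset.sum_comm, ← sum_initD hα hβ]
  refine Finset.sum_congr rfl fun s _ => ?_
  rw [← Finset.mul_sum, Finset.sum_comm, sum_lik, mul_one]

lemma outProb_nonneg (hα : 0 < α ∧ α < 1) (hβ : 0 < β ∧ β < 1) (x y : List Bool) :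
    0 ≤ outProb α β x y :=
  Finset.sum_nonneg fun s _ => mul_nonneg (initD_nonneg hα hβ s)
    (Finset.sum_nonneg fun t _ => lik_nonneg hα hβ x y s t)

lemma prob_input (hα : 0 < α ∧ α < 1) (hβ : 0 < β ∧ β < 1) (n : ℕ) (x : Fin n → Bool) :
    prob (pJoint α β n) (fun ω => ω.1 = x) = (1 / 2 : ℝ) ^ n := by
  rw [prob_eq_sum_fiber (pJoint α β n) yOut _ (shortWords n) yOut_mem]
  simp only [prob_yOut_and, ← Finset.mul_sum]
  have := sum_outProb hα hβ (List.ofFn x)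
  rw [List.length_ofFn] at this
  rw [this, mul_one]

lemma prob_yOut (n : ℕ) (y : List Bool) :
    prob (pJoint α β n) (fun ω => yOut ω = y) = avg n fun x => outProb α β x y := by
  rw [prob_eq_sum_fiber (pJoint α β n) Prod.fst _ Finset.univ (fun _ => Finset.mem_univ _), avg,
    Finset.mul_sum]
  refine Finset.sum_congr rfl fun x _ => ?_
  rw [← prob_yOut_and]
  simp only [and_comm]

lemma condEnt_yOut (hα : 0 < α ∧ α < 1) (hβ : 0 < β ∧ β < 1) (n : ℕ) :
    condEnt (pJoint α β n) (fun ω => yOut ω) (fun ω => ω.1) =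
      (avg n fun x => ∑ y ∈ shortWords n, Real.negMulLog (outProb α β x y)) / Real.log 2 := by
  rw [condEnt_eq_sum _ _ _ (shortWords n) Finset.univ yOut_mem (fun _ => Finset.mem_univ _),
    Finset.sum_comm, avg, mul_div_assoc, Finset.sum_div, Finset.mul_sum, ← Finset.sum_neg_distrib]
  refine Finset.sum_congr rfl fun x _ => ?_
  rw [Finset.sum_div, Finset.mul_sum, ← Finset.sum_neg_distrib]
  refine Finset.sum_congr rfl fun y _ => ?_
  rw [← neg_mul_logb_two, prob_input hα hβ, prob_yOut_and, mul_div_cancel_left₀ _ (by positivity)]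
  ring

lemma ent_yOut (hα : 0 < α ∧ α < 1) (hβ : 0 < β ∧ β < 1) (n : ℕ) :
    ent (pJoint α β n) (fun ω => yOut ω) =
      (∑ y ∈ shortWords n, Real.negMulLog (avg n fun x => outProb α β x y)) / Real.log 2 := by
  have h1 : prob (pJoint α β n) (fun _ => True) = 1 := by
    rw [prob_eq_sum_fiber (pJoint α β n) Prod.fst _ Finset.univ (fun _ => Finset.mem_univ _)]
    simp only [and_true, prob_input hα hβ]
    simp
  rw [ent, condEnt_eq_sum _ _ _ (shortWords n) Finset.univ yOut_mem (fun _ => Finset.mem_univ _),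
    Finset.sum_div, ← Finset.sum_neg_distrib]
  refine Finset.sum_congr rfl fun y _ => ?_
  rw [← neg_mul_logb_two, ← prob_yOut]
  simp only [Finset.univ_unique, Finset.sum_singleton, and_true, PUnit.default_eq_unit, h1,
    div_one]

/-! ### The conditional entropy rate of the output -/

lemma negMulLog_four {a b c d : ℝ} (ha : 0 ≤ a) (hb : 0 ≤ b) (hc : 0 ≤ c) (hd : 0 ≤ d) :
    Real.negMulLog (a + b + (c + d)) ≤
      Real.negMulLog a + Real.negMulLog b + (Real.negMulLog c + Real.negMulLog d) ∧
    Real.negMulLog a + Real.negMulLog b + (Real.negMulLog c + Real.negMulLog d) ≤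
      Real.negMulLog (a + b + (c + d)) + 2 * (a + b + (c + d)) := by
  have h1 := eta_nonneg ha hb
  have h2 := eta_nonneg hc hd
  have h3 := eta_nonneg (add_nonneg ha hb) (add_nonneg hc hd)
  have h4 := eta_le_add ha hb
  have h5 := eta_le_add hc hd
  have h6 := eta_le_add (add_nonneg ha hb) (add_nonneg hc hd)
  simp only [eta] at *
  constructor <;> linarith

lemma sum_negMulLog_joint (x : List Bool) :
    ∑ y ∈ shortWords x.length, ∑ s : Bool, ∑ t : Bool,
      Real.negMulLog (initD α β s * lik α β x y s t) =
    ∑ s : Bool, Real.negMulLog (initD α β s) + ∑ s : Bool, initD α β s * outEnt α β x s := by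
  rw [Finset.sum_comm, ← Finset.sum_add_distrib]
  refine Finset.sum_congr rfl fun s _ => ?_
  rw [Finset.sum_comm]
  simp only [Real.negMulLog_mul, Finset.sum_add_distrib, ← Finset.mul_sum, ← Finset.sum_mul,
    sum_lik, one_mul, outEnt]

lemma condEnt_bounds (hα : 0 < α ∧ α < 1) (hβ : 0 < β ∧ β < 1) (x : List Bool) :
    ∑ y ∈ shortWords x.length, Real.negMulLog (outProb α β x y) ≤
      ∑ s : Bool, Real.negMulLog (initD α β s) + ∑ s : Bool, initD α β s * outEnt α β x s ∧
    ∑ s : Bool, Real.negMulLog (initD α β s) + ∑ s : Bool, initD α β s * outEnt α β x s ≤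
      ∑ y ∈ shortWords x.length, Real.negMulLog (outProb α β x y) + 2 := by
  have hp : ∀ s t y, 0 ≤ initD α β s * lik α β x y s t := fun s t y =>
    mul_nonneg (initD_nonneg hα hβ s) (lik_nonneg hα hβ x y s t)
  have h2 : (2 : ℝ) = ∑ y ∈ shortWords x.length, 2 * outProb α β x y := by
    rw [← Finset.mul_sum, sum_outProb hα hβ, mul_one]
  rw [← sum_negMulLog_joint x]
  constructor
  · refine Finset.sum_le_sum fun y _ => ?_
    simp only [Fintype.sum_bool, outProb, mul_add]
    exact (negMulLog_four (hp _ _ _) (hp _ _ _) (hp _ _ _) (hp _ _ _)).1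
  · conv_rhs => rw [h2, ← Finset.sum_add_distrib]
    refine Finset.sum_le_sum fun y _ => ?_
    simp only [Fintype.sum_bool, outProb, mul_add (initD α β _)]
    exact (negMulLog_four (hp _ _ _) (hp _ _ _) (hp _ _ _) (hp _ _ _)).2

lemma tendsto_condEnt_yOut (hα : 0 < α ∧ α < 1) (hβ : 0 < β ∧ β < 1) :
    Tendsto (fun n : ℕ => condEnt (pJoint α β n) (fun ω => yOut ω) (fun ω => ω.1) / n) atTop
      (nhds ((chainRate α β - posEntLim α β) / Real.log 2)) := by
  have h2 : 0 < Real.log 2 := Real.log_pos (by norm_num)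
  have hmain : Tendsto (fun n : ℕ => (avg n fun x => ∑ y ∈ shortWords n,
      Real.negMulLog (outProb α β x y)) / n) atTop (nhds (chainRate α β - posEntLim α β)) := by
    set c := ∑ s : Bool, Real.negMulLog (initD α β s) with hc
    have hd : ∀ e : ℝ, Tendsto (fun n : ℕ => outEntAvg α β n / n + e / n) atTop
        (nhds (chainRate α β - posEntLim α β)) := by
      intro e
      have h1 := (tendsto_outEntAvg_div hα hβ).add (tendsto_const_div_atTop_nhds_zero_nat e)
      rwa [add_zero] at h1
    refine tendsto_of_tendsto_of_tendsto_of_le_of_le (hd (c - 2)) (hd c) (fun n => ?_) fun n => ?_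
    · simp only [← add_div]
      refine div_le_div_of_nonneg_right ?_ (by positivity)
      have : avg n (fun x => c + ∑ s : Bool, initD α β s * outEnt α β x s) ≤
          avg n (fun x => ∑ y ∈ shortWords n, Real.negMulLog (outProb α β x y) + 2) :=
        avg_mono fun x hx => by subst hx; exact (condEnt_bounds hα hβ x).2
      rw [avg_add, avg_add, avg_const, avg_const, ← outEntAvg] at this
      linarith
    · simp only [← add_div]
      refine div_le_div_of_nonneg_right ?_ (by positivity)
      have : avg n (fun x => ∑ y ∈ shortWords n, Real.negMulLog (outProb α β x y)) ≤
          avg n (fun x => c + ∑ s : Bool, initD α β s * outEnt α β x s) :=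
        avg_mono fun x hx => by subst hx; exact (condEnt_bounds hα hβ x).1
      rw [avg_add, avg_const, ← outEntAvg] at this
      linarith
  refine (hmain.div_const (Real.log 2)).congr fun n => ?_
  rw [condEnt_yOut hα hβ, div_right_comm]

/-! ### The entropy rate of the output -/

variable (α β) in
/-- Joint probability of the output length and the final state after `n` symbols, given the
initial state. -/
def lenProb : ℕ → ℕ → Bool → Bool → ℝ
  | 0, k, s, t => if k = 0 then transD α β s t else 0
  | n + 1, 0, s, t => transD α β s true * lenProb n 0 true t
  | n + 1, k + 1, s, t => transD α β s true * lenProb n (k + 1) true t +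
      transD α β s false * lenProb n k false t

variable (α β) in
lemma avg_lik (n : ℕ) (y : List Bool) (s t : Bool) :
    avg n (fun x => lik α β x y s t) = (1 / 2 : ℝ) ^ y.length * lenProb α β n y.length s t := by
  induction n generalizing y s with
  | zero => cases y <;> simp [lik, lenProb]
  | succ n ih =>
    simp only [avg_cons, lik_cons, avg_add, avg_const_mul, ih]
    cases y with
    | nil => simp [front, lenProb]
    | cons c y =>
      cases c <;> simp [front, lenProb, ih, pow_succ] <;> ring

lemma sum_shortWords_length (n : ℕ) (φ : ℕ → ℝ) :
    ∑ y ∈ shortWords n, (1 / 2 : ℝ) ^ y.length * φ y.length = ∑ k ∈ Finset.range (n + 1), φ k := by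
  induction n generalizing φ with
  | zero => simp
  | succ n ih =>
    rw [sum_shortWords_succ, Finset.sum_range_succ', ← ih (fun k => φ (k + 1))]
    simp only [List.length_cons, pow_succ, Fintype.sum_bool, List.length_nil, pow_zero, one_mul]
    rw [← Finset.sum_add_distrib, add_comm]
    congr 1
    exact Finset.sum_congr rfl fun y _ => by ring

lemma chainExp_const_add (n : ℕ) (s : Bool) (c : ℝ) (F : List Bool → ℝ) :
    chainExp α β n s (fun d => c + F d) = c + chainExp α β n s F := by
  induction n generalizing s F with
  | zero => rfl
  | succ n ih =>
    simp only [chainExp, ih, mul_add, Finset.sum_add_distrib, ← Finset.sum_mul, sum_transD, one_mul]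

lemma mean_length (hα : 0 < α ∧ α < 1) (hβ : 0 < β ∧ β < 1) : ∀ x : List Bool,
    ∑ s : Bool, initD α β s * chainExp α β x.length s (fun d => ((yList x d).length : ℝ)) =
      x.length * initD α β false
  | [] => by simp [chainExp]
  | a :: x => by
    have ih := mean_length hα hβ x
    have hf := sum_initD_mul_transD hα hβ false
    have ht := sum_initD_mul_transD hα hβ true
    simp only [List.length_cons, chainExp, Fintype.sum_bool, yList_cons_true, yList_cons_false,
      Nat.cast_add, Nat.cast_one, add_comm _ (1 : ℝ), chainExp_const_add] at ih hf ht ⊢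
    rw [add_mul, one_mul, ← ih]
    linear_combination (1 + chainExp α β x.length false fun d => ((yList x d).length : ℝ)) * hf +
      (chainExp α β x.length true fun d => ((yList x d).length : ℝ)) * ht

lemma sum_outProb_mul_length (hα : 0 < α ∧ α < 1) (hβ : 0 < β ∧ β < 1) (x : List Bool) :
    ∑ y ∈ shortWords x.length, outProb α β x y * y.length = x.length * initD α β false := by
  rw [← mean_length hα hβ]
  simp only [← sum_lik_mul α β x _ (fun y => (y.length : ℝ)), outProb, Finset.sum_mul]
  rw [Finset.sum_comm]
  refine Finset.sum_congr rfl fun s _ => ?_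
  rw [Finset.sum_comm, Finset.mul_sum]
  simp only [Finset.mul_sum, Finset.sum_mul, mul_assoc]

lemma ent_yOut_bounds (hα : 0 < α ∧ α < 1) (hβ : 0 < β ∧ β < 1) (n : ℕ) :
    n * initD α β false * Real.log 2 ≤ ent (pJoint α β n) (fun ω => yOut ω) * Real.log 2 ∧
    ent (pJoint α β n) (fun ω => yOut ω) * Real.log 2 ≤
      n * initD α β false * Real.log 2 + Real.log (n + 1) := by
  have h2 : 0 < Real.log 2 := Real.log_pos (by norm_num)
  set ℓ : ℕ → ℝ := fun k => ∑ s : Bool, initD α β s * ∑ t : Bool, lenProb α β n k s t with hℓ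
  have hP : ∀ y : List Bool, avg n (fun x => outProb α β x y) =
      (1 / 2 : ℝ) ^ y.length * ℓ y.length := by
    intro y
    simp only [outProb, avg_sum, avg_const_mul, avg_lik, hℓ, Finset.mul_sum]
    exact Finset.sum_congr rfl fun s _ => Finset.sum_congr rfl fun t _ => by ring
  have hone : ∑ k ∈ Finset.range (n + 1), ℓ k = 1 := by
    rw [← sum_shortWords_length]
    simp only [← hP]
    rw [← avg_sum, ← avg_const n 1]
    exact avg_congr fun x hx => by subst hx; exact sum_outProb hα hβ x
  have hmean : ∑ k ∈ Finset.range (n + 1), ℓ k * k = n * initD α β false := by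
    rw [← sum_shortWords_length n fun k => ℓ k * k]
    simp only [← mul_assoc, ← hP]
    rw [← avg_const n (n * initD α β false)]
    rw [show (∑ y ∈ shortWords n, (avg n fun x => outProb α β x y) * (y.length : ℝ)) =
      avg n (fun x => ∑ y ∈ shortWords n, outProb α β x y * y.length) by
        rw [avg_sum]
        refine Finset.sum_congr rfl fun y _ => ?_
        rw [mul_comm, ← avg_const_mul]
        simp only [mul_comm]]
    exact avg_congr fun x hx => by subst hx; exact sum_outProb_mul_length hα hβ x
  have hnn : ∀ k, 0 ≤ ℓ k := by
    intro k
    have h := hP (List.replicate k true)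
    rw [List.length_replicate] at h
    have h0 : 0 ≤ avg n (fun x => outProb α β x (List.replicate k true)) := by
      rw [← avg_const n 0]
      exact avg_mono fun x _ => outProb_nonneg hα hβ x _
    rw [h] at h0
    exact nonneg_of_mul_nonneg_right h0 (by positivity)
  have hent : ent (pJoint α β n) (fun ω => yOut ω) * Real.log 2 =
      n * initD α β false * Real.log 2 + ∑ k ∈ Finset.range (n + 1), Real.negMulLog (ℓ k) := by
    rw [ent_yOut hα hβ, div_mul_cancel₀ _ h2.ne', ← hmean, Finset.sum_mul,
      ← Finset.sum_add_distrib, ← sum_shortWords_length]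
    refine Finset.sum_congr rfl fun y _ => ?_
    rw [hP, Real.negMulLog_mul, Real.negMulLog, Real.log_pow, one_div, Real.log_inv]
    ring
  rw [hent]
  constructor
  · have : 0 ≤ ∑ k ∈ Finset.range (n + 1), Real.negMulLog (ℓ k) :=
      Finset.sum_nonneg fun k hk => Real.negMulLog_nonneg (hnn k)
        (hone ▸ Finset.single_le_sum (fun i _ => hnn i) hk)
    linarith
  · have hq : (0 : ℝ) < 1 / (n + 1) := by positivity
    have hk : ∀ k ∈ Finset.range (n + 1), Real.negMulLog (ℓ k) ≤
        ℓ k * Real.log (n + 1) + (1 / (n + 1) - ℓ k) := by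
      intro k hk
      have h := mul_log_ratio_le (s := 1) (hnn k)
        (hone ▸ Finset.single_le_sum (fun i _ => hnn i) hk) hq
      rw [one_div, Real.log_inv, Real.log_one, ← one_div] at h
      rw [Real.negMulLog]
      linarith
    have := Finset.sum_le_sum hk
    rw [Finset.sum_add_distrib, Finset.sum_sub_distrib, ← Finset.sum_mul, hone, Finset.sum_const,
      Finset.card_range, nsmul_eq_mul] at this
    have e : ((n + 1 : ℕ) : ℝ) * (1 / (n + 1)) = 1 := by push_cast; field_simp
    rw [e] at this
    linarith

lemma tendsto_log_succ_div : Tendsto (fun n : ℕ => Real.log (n + 1) / n) atTop (nhds 0) := by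
  have h1 : Tendsto (fun n : ℕ => Real.log n / n) atTop (nhds 0) :=
    (Real.isLittleO_log_id_atTop.tendsto_div_nhds_zero).comp tendsto_natCast_atTop_atTop
  have h2 := (tendsto_const_div_atTop_nhds_zero_nat (Real.log 2)).add h1
  rw [add_zero] at h2
  refine squeeze_zero' (Eventually.of_forall fun n => ?_)
    ((eventually_gt_atTop 0).mono fun n hn => ?_) h2
  · exact div_nonneg (Real.log_nonneg (by simp)) (by positivity)
  · have h0 : (1 : ℝ) ≤ n := by exact_mod_cast hn
    rw [← add_div, ← Real.log_mul (by norm_num) (by positivity)]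
    exact div_le_div_of_nonneg_right (Real.log_le_log (by positivity) (by linarith)) (by positivity)

lemma tendsto_ent_yOut (hα : 0 < α ∧ α < 1) (hβ : 0 < β ∧ β < 1) :
    Tendsto (fun n : ℕ => ent (pJoint α β n) (fun ω => yOut ω) / n) atTop
      (nhds (initD α β false)) := by
  have h2 : 0 < Real.log 2 := Real.log_pos (by norm_num)
  have hup : Tendsto (fun n : ℕ => initD α β false + Real.log (n + 1) / n / Real.log 2) atTop
      (nhds (initD α β false)) := by
    simpa using (tendsto_log_succ_div.div_const (Real.log 2)).const_add (initD α β false)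
  refine tendsto_of_tendsto_of_tendsto_of_le_of_le' tendsto_const_nhds hup
    ((eventually_gt_atTop 0).mono fun n hn => ?_) ((eventually_gt_atTop 0).mono fun n hn => ?_)
  · have h0 : (0 : ℝ) < n := by exact_mod_cast hn
    rw [le_div_iff₀ h0]
    have := (ent_yOut_bounds hα hβ n).1
    have := le_of_mul_le_mul_right this h2
    linarith
  · have h0 : (0 : ℝ) < n := by exact_mod_cast hn
    have := (ent_yOut_bounds hα hβ n).2
    rw [← le_div_iff₀ h2] at this
    rw [div_le_iff₀ h0]
    refine this.trans_eq ?_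
    field_simp

lemma tendsto_Iseq (hα : 0 < α ∧ α < 1) (hβ : 0 < β ∧ β < 1) :
    Tendsto (fun n : ℕ => Iseq α β n) atTop
      (nhds (initD α β false - (chainRate α β - posEntLim α β) / Real.log 2)) :=
  ((tendsto_ent_yOut hα hβ).sub (tendsto_condEnt_yOut hα hβ)).congr fun n => by
    rw [Iseq, sub_div]

end Model

/-! ### Shifted runs -/

/-- The length of the longest initial segment of `x` that agrees with `x` shifted by `e + 1`. -/
def run (e : ℕ) : List Bool → ℕ
  | [] => 0
  | a :: x => if x[e]? = some a then run e x + 1 else 0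

lemma avg_le_run (e l : ℕ) : ∀ n, l + e + 1 ≤ n →
    avg n (fun x => if l ≤ run e x then 1 else 0) = (1 / 2 : ℝ) ^ l := by
  induction l with
  | zero => intro n _; simp
  | succ l ih =>
    rintro (_ | n) hn
    · omega
    rw [avg_cons, Fintype.sum_bool, ← avg_add, pow_succ', ← ih n (by omega)]
    congr 1
    refine avg_congr fun x hx => ?_
    have he : x[e]? = some (x[e]'(by omega)) := List.getElem?_eq_getElem _
    simp only [run, he, Option.some.injEq]
    cases x[e]'(by omega) <;> simp

lemma avg_classEnt_min {h e n : ℕ} (hn : h + e + 1 ≤ n) :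
    avg n (fun x => classEnt (min h (run e x))) = partC h := by
  simp only [← sum_classInc_ite, avg_sum, partC]
  refine Finset.sum_congr rfl fun l hl => ?_
  have := Finset.mem_range.1 hl
  rw [← avg_le_run e (l + 1) n (by omega), mul_comm, ← avg_const_mul]
  simp only [mul_ite, mul_one, mul_zero]

lemma partC_le_avg_classEnt {h e n : ℕ} (hn : h + e + 1 ≤ n) :
    partC h ≤ avg n (fun x => classEnt (run e x)) := by
  rw [← avg_classEnt_min hn]
  exact avg_mono fun x _ => classEnt_mono (min_le_right _ _)

/-! ### The lower bound -/

section Lower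

variable {α β : ℝ}

lemma lik_self_ge (hα : 0 < α ∧ α < 1) (hβ : 0 < β ∧ β < 1) : ∀ x : List Bool,
    (1 - β) ^ (x.length + 1) ≤ lik α β x x false false
  | [] => by simp [lik, transD]
  | a :: x => by
    have ih := lik_self_ge hα hβ x
    have h1 : 0 ≤ transD α β false true * lik α β x (a :: x) true false :=
      mul_nonneg (transD_nonneg hα hβ _ _) (lik_nonneg hα hβ _ _ _ _)
    have h2 : transD α β false false = 1 - β := by simp [transD]
    rw [lik_cons, front_cons_self, h2, List.length_cons, pow_succ']
    have := mul_le_mul_of_nonneg_left ih (sub_nonneg.2 hβ.2.le)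
    linarith

lemma lik_drop_true_ge (hα : 0 < α ∧ α < 1) (hβ : 0 < β ∧ β < 1) : ∀ (x : List Bool) (c : ℕ),
    c ≤ x.length →
    (1 - α) ^ c * α * (1 - β) ^ (x.length - c) ≤ lik α β x (x.drop c) true false
  | [], c, hc => by
    obtain rfl : c = 0 := by simpa using hc
    simp [lik, transD]
  | a :: x, 0, _ => by
    have ih := lik_self_ge hα hβ x
    have h1 : 0 ≤ transD α β true true * lik α β x (a :: x) true false :=
      mul_nonneg (transD_nonneg hα hβ _ _) (lik_nonneg hα hβ _ _ _ _)
    have h2 : transD α β true false = α := by simp [transD]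
    rw [List.drop_zero, lik_cons, front_cons_self, h2, List.length_cons, Nat.sub_zero, pow_zero,
      one_mul]
    have := mul_le_mul_of_nonneg_left ih hα.1.le
    linarith
  | a :: x, c + 1, hc => by
    have ih := lik_drop_true_ge hα hβ x c (by simpa using hc)
    have h1 : 0 ≤ transD α β true false * front a (fun z => lik α β x z false false) (x.drop c) :=
      mul_nonneg (transD_nonneg hα hβ _ _) (front_nonneg (fun z => lik_nonneg hα hβ _ _ _ _) _)
    have h2 : transD α β true true = 1 - α := by simp [transD]
    rw [List.drop_succ_cons, lik_cons, h2, List.length_cons, Nat.succ_sub_succ, pow_succ']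
    have := mul_le_mul_of_nonneg_left ih (sub_nonneg.2 hα.2.le)
    linarith

lemma drop_eq_cons {e : ℕ} {a : Bool} {x : List Bool} (h : x[e]? = some a) :
    x.drop e = a :: x.drop (e + 1) := by
  obtain ⟨he, rfl⟩ := List.getElem?_eq_some_iff.1 h
  exact List.drop_eq_getElem_cons he

lemma lik_drop_ge (hα : 0 < α ∧ α < 1) (hβ : 0 < β ∧ β < 1) (e : ℕ) : ∀ x : List Bool,
    e + 1 ≤ x.length →
    β * (1 - α) ^ e * α * (1 - β) ^ (x.length - (e + 1)) * (run e x + 1) ≤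
      lik α β x (x.drop (e + 1)) false false
  | [], hc => by simp at hc
  | a :: x, hc => by
    have h1 := lik_drop_true_ge hα hβ x e (by simpa using hc)
    have h2 : transD α β false true = β := by simp [transD]
    have h3 : transD α β false false = 1 - β := by simp [transD]
    rw [List.drop_succ_cons, lik_cons, h2, h3, List.length_cons, Nat.succ_sub_succ, run]
    have h4 := mul_le_mul_of_nonneg_left h1 hβ.1.le
    split_ifs with hx
    · rw [drop_eq_cons hx, front_cons_self, ← drop_eq_cons hx]
      obtain ⟨he, -⟩ := List.getElem?_eq_some_iff.1 hx
      have h5 := mul_le_mul_of_nonneg_left (lik_drop_ge hα hβ e x he) (sub_nonneg.2 hβ.2.le)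
      have h6 : (1 - β) ^ (x.length - e) = (1 - β) * (1 - β) ^ (x.length - (e + 1)) := by
        rw [← pow_succ']; congr 1; omega
      rw [h6] at h4 ⊢
      push_cast
      linarith
    · have h5 : 0 ≤ (1 - β) * front a (fun z => lik α β x z false false) (x.drop e) :=
        mul_nonneg (sub_nonneg.2 hβ.2.le) (front_nonneg (fun z => lik_nonneg hα hβ _ _ _ _) _)
      push_cast
      linarith

lemma posEnt_ge (hα : 0 < α ∧ α < 1) (hβ : 0 < β ∧ β < 1) (h : ℕ) : ∀ x : List Bool, h < x.length →
    ∑ e ∈ Finset.range h, β * (1 - α) ^ e * α * (1 - β) ^ x.length * classEnt (run e x) ≤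
      posEnt α β x false
  | [], hx => by simp at hx
  | a :: x, hx => by
    have hβ0 : 0 ≤ 1 - β := sub_nonneg.2 hβ.2.le
    have hα0 : 0 ≤ 1 - α := sub_nonneg.2 hα.2.le
    have hαp := hα.1.le
    have hβp := hβ.1.le
    have hxl : h ≤ x.length := by simpa [Nat.lt_succ_iff] using hx
    have hn1 : ∀ y t, 0 ≤ transD α β false true * lik α β x y true t := fun y t =>
      mul_nonneg (transD_nonneg hα hβ _ _) (lik_nonneg hα hβ _ _ _ _)
    have hn2 : ∀ y t, 0 ≤ transD α β false false * front a (fun z => lik α β x z false t) y :=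
      fun y t => mul_nonneg (transD_nonneg hα hβ _ _)
        (front_nonneg (fun z => lik_nonneg hα hβ _ _ _ _) _)
    have hsub : (Finset.range h).image (fun e => x.drop e) ⊆ shortWords (x.length + 1) := by
      intro y hy
      obtain ⟨e, -, rfl⟩ := Finset.mem_image.1 hy
      simp; omega
    have hinj : Set.InjOn (fun e => x.drop e) (Finset.range h : Set ℕ) := by
      intro e he e' he' hee
      have := congrArg List.length hee
      simp at this he he'
      omega
    rw [posEnt, Fintype.sum_bool]
    refine le_trans ?_ (le_add_of_nonneg_left
      (Finset.sum_nonneg fun y _ => eta_nonneg (hn1 y true) (hn2 y true)))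
    refine le_trans ?_ (Finset.sum_le_sum_of_subset_of_nonneg hsub fun y _ _ =>
      eta_nonneg (hn1 y false) (hn2 y false))
    rw [Finset.sum_image hinj]
    refine Finset.sum_le_sum fun e he => ?_
    have he' := Finset.mem_range.1 he
    have h2 : transD α β false true = β := by simp [transD]
    have h3 : transD α β false false = 1 - β := by simp [transD]
    set w := β * (1 - α) ^ e * α * (1 - β) ^ (x.length - e) with hw
    have hw0 : 0 ≤ w := by positivity
    have hle : β * (1 - α) ^ e * α * (1 - β) ^ (a :: x).length ≤ w := by
      refine mul_le_mul_of_nonneg_left (pow_le_pow_of_le_one hβ0 (by linarith) ?_) (by positivity)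
      simp; omega
    refine (mul_le_mul_of_nonneg_right hle (classEnt_nonneg _)).trans ?_
    rw [← eta_mul_natCast]
    refine eta_mono hw0 (by positivity) ?_ ?_
    · have h4 := mul_le_mul_of_nonneg_left (lik_drop_true_ge hα hβ x e (by omega)) hβp
      rw [h2]
      linarith
    · rw [h3, run]
      split_ifs with hxe
      · rw [drop_eq_cons hxe, front_cons_self]
        obtain ⟨hel, -⟩ := List.getElem?_eq_some_iff.1 hxe
        have h5 := mul_le_mul_of_nonneg_left (lik_drop_ge hα hβ e x hel) hβ0
        have h6 : (1 - β) ^ (x.length - e) = (1 - β) * (1 - β) ^ (x.length - (e + 1)) := by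
          rw [← pow_succ']; congr 1; omega
        rw [hw, h6]
        push_cast
        linarith
      · rw [Nat.cast_zero, mul_zero, ← h3]
        exact hn2 _ _

lemma posEntLim_ge (hα : 0 < α ∧ α < 1) (hβ : 0 < β ∧ β < 1) (h : ℕ) :
    α / (α + β) * (β * (1 - β) ^ (2 * h + 1) * ((1 - (1 - α) ^ h) * partC h)) ≤
      posEntLim α β := by
  refine le_trans ?_ (le_ciSup (bddAbove_posEntAvg hα hβ) (2 * h))
  have hβ0 : 0 ≤ 1 - β := sub_nonneg.2 hβ.2.le
  have hα0 : 0 ≤ 1 - α := sub_nonneg.2 hα.2.le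
  have hαp := hα.1.le
  have hβp := hβ.1.le
  have hgeom : ∑ e ∈ Finset.range h, (1 - α) ^ e * α = 1 - (1 - α) ^ h := by
    rw [← Finset.sum_mul]
    have := geom_sum_mul (1 - α) h
    linarith
  have h1 : α / (α + β) * avg (2 * h + 1) (fun x => ∑ e ∈ Finset.range h,
      β * (1 - α) ^ e * α * (1 - β) ^ (2 * h + 1) * classEnt (run e x)) ≤ posEntAvg α β (2 * h) := by
    rw [posEntAvg, ← avg_const_mul]
    refine avg_mono fun x hx => ?_
    have h2 := posEnt_ge hα hβ h x (by omega)
    rw [hx] at h2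
    have h3 := mul_le_mul_of_nonneg_left h2 (initD_nonneg hα hβ false)
    have h4 := mul_nonneg (initD_nonneg hα hβ true) (posEnt_nonneg hα hβ x true)
    rw [Fintype.sum_bool]
    simp only [initD, if_true, Bool.false_eq_true, if_false] at h3 h4 ⊢
    linarith
  refine le_trans ?_ h1
  refine mul_le_mul_of_nonneg_left ?_ (by positivity)
  rw [avg_sum, ← hgeom, Finset.sum_mul, Finset.mul_sum]
  refine Finset.sum_le_sum fun e he => ?_
  have he' := Finset.mem_range.1 he
  rw [avg_const_mul]
  have h5 := mul_le_mul_of_nonneg_left (partC_le_avg_classEnt (h := h) (e := e) (n := 2 * h + 1)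
    (by omega)) (show 0 ≤ β * (1 - α) ^ e * α * (1 - β) ^ (2 * h + 1) by positivity)
  linarith

end Lower

lemma take_drop_eq_take {e l : ℕ} {x : List Bool} (h : l ≤ run e x) :
    (x.drop (e + 1)).take l = x.take l := by
  induction l generalizing x with
  | zero => simp
  | succ l ih =>
    cases x with
    | nil => simp
    | cons a x =>
      rw [run] at h
      split_ifs at h with hx
      · rw [List.drop_succ_cons, drop_eq_cons hx, List.take_succ_cons, List.take_succ_cons,
          ih (by omega)]
      · omega

lemma le_run {e l : ℕ} {x : List Bool} (hx : l + e + 1 ≤ x.length)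
    (h : (x.drop (e + 1)).take l = x.take l) : l ≤ run e x := by
  induction l generalizing x with
  | zero => simp
  | succ l ih =>
    cases x with
    | nil => simp at hx
    | cons a x =>
      simp only [List.length_cons] at hx
      rw [List.drop_succ_cons, List.drop_eq_getElem_cons (show e < x.length by omega),
        List.take_succ_cons, List.take_succ_cons, List.cons.injEq] at h
      have hxe : x[e]? = some a := by rw [List.getElem?_eq_getElem (by omega), h.1]
      rw [run, if_pos hxe]
      exact Nat.succ_le_succ (ih (by omega) h.2)

lemma le_run_drop {c e e' l : ℕ} {x : List Bool} (hlt : e < e') (hx : c + e' + l ≤ x.length)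
    (h : (x.drop (c + e)).take l = (x.drop (c + e')).take l) :
    l ≤ run (e' - e - 1) (x.drop (c + e)) := by
  refine le_run (by simp; omega) ?_
  rw [List.drop_drop, h]
  congr 2
  omega

lemma avg_drop (c n : ℕ) (F : List Bool → ℝ) : avg (n + c) (fun x => F (x.drop c)) = avg n F := by
  induction c with
  | zero => simp
  | succ c ih =>
    rw [← add_assoc, avg_cons]
    simp only [List.drop_succ_cons, ih, Fintype.sum_bool]
    ring

/-- `x` has a long self-overlap near its beginning. -/
def Repetitive (h m : ℕ) (x : List Bool) : Prop :=
  ∃ c ≤ 2 * m, ∃ e < m, h ≤ run e (x.drop c)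

lemma avg_repetitive_le {h m n : ℕ} (hn : h + 3 * m ≤ n) :
    avg n (fun x => if Repetitive h m x then 1 else 0) ≤
      (2 * m + 1) * m * (1 / 2 : ℝ) ^ h := by
  have h1 : avg n (fun x => if Repetitive h m x then 1 else 0) ≤
      avg n (fun x => ∑ c ∈ Finset.range (2 * m + 1), ∑ e ∈ Finset.range m,
        if h ≤ run e (x.drop c) then (1 : ℝ) else 0) := by
    refine avg_mono fun x _ => ?_
    have hnn : ∀ c e : ℕ, (0 : ℝ) ≤ if h ≤ run e (x.drop c) then (1 : ℝ) else 0 := by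
      intro c e; positivity
    split_ifs with hb
    · obtain ⟨c, hc, e, he, hr⟩ := hb
      refine le_trans ?_ (Finset.single_le_sum (fun c _ => Finset.sum_nonneg fun e _ => hnn c e)
        (Finset.mem_range.2 (Nat.lt_succ_of_le hc)))
      refine le_trans ?_ (Finset.single_le_sum (fun e _ => hnn c e) (Finset.mem_range.2 he))
      simp [hr]
    · exact Finset.sum_nonneg fun c _ => Finset.sum_nonneg fun e _ => hnn c e
  refine h1.trans (le_of_eq ?_)
  have h2 : ∀ c ∈ Finset.range (2 * m + 1), ∀ e ∈ Finset.range m,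
      avg n (fun x => if h ≤ run e (x.drop c) then (1 : ℝ) else 0) = (1 / 2 : ℝ) ^ h := by
    intro c hc e he
    have hc' := Finset.mem_range.1 hc
    have he' := Finset.mem_range.1 he
    obtain ⟨k, rfl⟩ : ∃ k, n = k + c := ⟨n - c, by omega⟩
    rw [avg_drop c k (fun x => if h ≤ run e x then (1 : ℝ) else 0), avg_le_run e h k (by omega)]
  simp only [avg_sum]
  rw [Finset.sum_congr rfl fun c hc => Finset.sum_congr rfl (h2 c hc)]
  simp
  ring

/-! ### Deletion patterns with few bursts -/

lemma yList_replicate_true (b : ℕ) (x d : List Bool) :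
    yList x (List.replicate b true ++ d) = yList (x.drop b) d := by
  induction b generalizing x with
  | zero => simp
  | succ b ih =>
    cases x with
    | nil => simp
    | cons a x => simp [List.replicate_succ, ih]

lemma yList_replicate_false (i : ℕ) (x d : List Bool) :
    yList x (List.replicate i false ++ d) = x.take i ++ yList (x.drop i) d := by
  induction i generalizing x with
  | zero => simp
  | succ i ih =>
    cases x with
    | nil => simp
    | cons a x => simp [List.replicate_succ, ih]

lemma take_yList_burst {i b m : ℕ} (him : i ≤ m) {x d : List Bool} (hx : i + b + m ≤ x.length) :
    (yList x (List.replicate i false ++ (List.replicate b true ++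
      (List.replicate m false ++ d)))).take m = x.take i ++ (x.drop (i + b)).take (m - i) := by
  rw [yList_replicate_false, yList_replicate_true, yList_replicate_false, List.drop_drop,
    List.take_append, List.take_of_length_le (by simp; omega), List.length_take,
    min_eq_left (by omega), List.take_append_of_le_length (by simp; omega), List.take_take,
    min_eq_left (by omega)]

section ChainBounds

variable {α β : ℝ}

lemma chainExp_mono (hα : 0 < α ∧ α < 1) (hβ : 0 < β ∧ β < 1) (n : ℕ) (s : Bool)
    {F G : List Bool → ℝ} (h : ∀ d, F d ≤ G d) : chainExp α β n s F ≤ chainExp α β n s G := by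
  induction n generalizing s F G with
  | zero => exact h _
  | succ n ih =>
    exact Finset.sum_le_sum fun b _ =>
      mul_le_mul_of_nonneg_left (ih b fun d => h _) (transD_nonneg hα hβ s b)

lemma chainExp_le (hα : 0 < α ∧ α < 1) (hβ : 0 < β ∧ β < 1) (n : ℕ) (s : Bool)
    {F : List Bool → ℝ} {c : ℝ} (h : ∀ d, F d ≤ c) : chainExp α β n s F ≤ c :=
  (chainExp_mono hα hβ n s h).trans_eq (chainExp_const α β n s c)

lemma chainExp_nonneg (hα : 0 < α ∧ α < 1) (hβ : 0 < β ∧ β < 1) (n : ℕ) (s : Bool)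
    {F : List Bool → ℝ} (h : ∀ d, 0 ≤ F d) : 0 ≤ chainExp α β n s F :=
  (chainExp_const α β n s 0).symm.trans_le (chainExp_mono hα hβ n s h)

lemma chainExp_succ_false (n : ℕ) (F : List Bool → ℝ) :
    chainExp α β (n + 1) false F = β * chainExp α β n true (fun d => F (true :: d)) +
      (1 - β) * chainExp α β n false (fun d => F (false :: d)) := by
  simp [chainExp, transD]

lemma chainExp_succ_true (n : ℕ) (F : List Bool → ℝ) :
    chainExp α β (n + 1) true F = (1 - α) * chainExp α β n true (fun d => F (true :: d)) +
      α * chainExp α β n false (fun d => F (false :: d)) := by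
  simp [chainExp, transD]

/-- Decomposition according to the position of the first deletion. -/
lemma chainExp_false_le_sum (hα : 0 < α ∧ α < 1) (hβ : 0 < β ∧ β < 1) {c : ℝ} (k : ℕ) :
    ∀ {n : ℕ} {F : List Bool → ℝ}, k ≤ n → (∀ d, 0 ≤ F d) →
    (∀ d, F (List.replicate k false ++ d) ≤ c) →
    chainExp α β n false F ≤ c + ∑ i ∈ Finset.range k,
      β * chainExp α β (n - i - 1) true (fun d => F (List.replicate i false ++ true :: d)) := by
  induction k with
  | zero =>
    intro n F _ _ h
    simpa using chainExp_le hα hβ n false (by simpa using h)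
  | succ k ih =>
    rintro (_ | n) F hk h0 h
    · omega
    have h1 := ih (n := n) (F := fun d => F (false :: d)) (by omega) (fun d => h0 _)
      (fun d => by simpa [List.replicate_succ] using h d)
    have h2 := chainExp_nonneg hα hβ n false (F := fun d => F (false :: d)) (fun d => h0 _)
    have h3 : 0 ≤ β * chainExp α β n false (fun d => F (false :: d)) := mul_nonneg hβ.1.le h2
    rw [chainExp_succ_false, Finset.sum_range_succ']
    have h4 : ∀ i, n + 1 - (i + 1) - 1 = n - i - 1 := fun i => by omega
    simp only [h4, List.replicate_succ, List.cons_append, List.replicate_zero, List.nil_append,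
      Nat.add_sub_cancel, Nat.sub_zero] at h1 ⊢
    linarith

lemma chainExp_false_le (hα : 0 < α ∧ α < 1) (hβ : 0 < β ∧ β < 1) {c Λ : ℝ} {k n : ℕ}
    {F : List Bool → ℝ} (hk : k ≤ n) (h0 : ∀ d, 0 ≤ F d) (hΛ : ∀ d, F d ≤ Λ)
    (h : ∀ d, F (List.replicate k false ++ d) ≤ c) :
    chainExp α β n false F ≤ c + k * (β * Λ) := by
  refine (chainExp_false_le_sum hα hβ k hk h0 h).trans ?_
  have h1 : ∀ i ∈ Finset.range k, β * chainExp α β (n - i - 1) true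
      (fun d => F (List.replicate i false ++ true :: d)) ≤ β * Λ := fun i _ =>
    mul_le_mul_of_nonneg_left (chainExp_le hα hβ _ _ fun d => hΛ _) hβ.1.le
  have h2 := Finset.sum_le_sum h1
  rw [Finset.sum_const, Finset.card_range, nsmul_eq_mul] at h2
  linarith

/-- Decomposition according to the length of the initial burst of deletions. -/
lemma chainExp_true_le_sum (hα : 0 < α ∧ α < 1) (hβ : 0 < β ∧ β < 1) {Λ : ℝ} (m k : ℕ) :
    ∀ {n : ℕ} {c : ℕ → ℝ} {F : List Bool → ℝ}, k + m ≤ n → (∀ d, 0 ≤ F d) →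
    (∀ d, F d ≤ Λ) → (∀ b < k, ∀ d, F (List.replicate b true ++ (List.replicate m false ++ d)) ≤ c b) →
    chainExp α β n true F ≤
      ∑ b ∈ Finset.range k, (1 - α) ^ b * α * (c b + m * (β * Λ)) + (1 - α) ^ k * Λ := by
  induction k with
  | zero =>
    intro n c F _ _ hΛ _
    simpa using chainExp_le hα hβ n true hΛ
  | succ k ih =>
    rintro (_ | n) c F hk h0 hΛ h
    · omega
    have hΛ0 : 0 ≤ Λ := (h0 []).trans (hΛ [])
    have h1 := ih (n := n) (c := fun b => c (b + 1)) (F := fun d => F (true :: d)) (by omega)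
      (fun d => h0 _) (fun d => hΛ _)
      (fun b hb d => by simpa [List.replicate_succ] using h (b + 1) (by omega) d)
    have h2 : chainExp α β n false (fun d => F (false :: d)) ≤ c 0 + m * (β * Λ) := by
      have hz := h 0 (by omega)
      simp only [List.replicate_zero, List.nil_append] at hz
      cases m with
      | zero =>
        have := chainExp_le hα hβ n false (F := fun d => F (false :: d)) (c := c 0)
          (fun d => by simpa using hz (false :: d))
        simpa using this
      | succ m =>
        have h3 := chainExp_false_le hα hβ (k := m) (n := n) (F := fun d => F (false :: d))
          (by omega) (fun d => h0 _) (fun d => hΛ _)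
          (fun d => by simpa [List.replicate_succ] using hz d)
        have h4 : 0 ≤ β * Λ := mul_nonneg hβ.1.le hΛ0
        push_cast
        linarith
    have h5 := mul_le_mul_of_nonneg_left h1 (sub_nonneg.2 hα.2.le)
    have h6 := mul_le_mul_of_nonneg_left h2 hα.1.le
    rw [chainExp_succ_true, Finset.sum_range_succ', pow_zero, one_mul]
    rw [mul_add, Finset.mul_sum] at h5
    have h7 : ∀ b, (1 - α) ^ (b + 1) * α * (c (b + 1) + m * (β * Λ)) =
        (1 - α) * ((1 - α) ^ b * α * (c (b + 1) + m * (β * Λ))) := fun b => by ring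
    simp only [h7]
    rw [pow_succ' (1 - α) k]
    linarith

end ChainBounds

/-! ### The upper bound -/

/-- The cost, in the deletion pattern `d`, of the guess `q` for the probability that the first
symbol is deleted. -/
def guessCost (q : ℝ) (d : List Bool) : ℝ :=
  if d.head? = some true then -Real.log q else -Real.log (1 - q)

lemma guessCost_nonneg {q : ℝ} (h0 : 0 < q) (h1 : q < 1) (d : List Bool) : 0 ≤ guessCost q d := by
  unfold guessCost
  split_ifs
  · linarith [Real.log_nonpos h0.le h1.le]
  · linarith [Real.log_nonpos (show 0 ≤ 1 - q by linarith) (by linarith)]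

lemma guessCost_le {q δ : ℝ} (hδ : 0 < δ) (h0 : δ ≤ q) (h1 : q ≤ 1 - δ) (d : List Bool) :
    guessCost q d ≤ -Real.log δ := by
  unfold guessCost
  split_ifs
  · linarith [Real.log_le_log hδ h0]
  · linarith [Real.log_le_log hδ (show δ ≤ 1 - q by linarith)]

lemma guessCost_false (q : ℝ) {i : ℕ} (hi : 0 < i) (d : List Bool) :
    guessCost q (List.replicate i false ++ d) = -Real.log (1 - q) := by
  obtain ⟨j, rfl⟩ := Nat.exists_eq_succ_of_ne_zero hi.ne'
  simp [guessCost, List.replicate_succ]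

lemma guessCost_true (q : ℝ) {b : ℕ} (hb : 0 < b) (d : List Bool) :
    guessCost q (List.replicate b true ++ d) = -Real.log q := by
  obtain ⟨j, rfl⟩ := Nat.exists_eq_succ_of_ne_zero hb.ne'
  simp [guessCost, List.replicate_succ]

/-- The guess used when the pattern starts in the deleting state. -/
def guessTrue (δ : ℝ) (m : ℕ) (x y : List Bool) : ℝ :=
  if y.take m = x.take m then δ else 1 - δ

/-- The guess used when the pattern starts in the transmitting state. -/
def guessFalse (δ : ℝ) (m : ℕ) (x y : List Bool) : ℝ :=
  if y.take m = x.take m then δ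
  else if H : ∃ e < m, y.take m = (x.drop (e + 1)).take m then
    max δ (min (1 - δ) (1 / ((run H.choose x : ℝ) + 1)))
  else δ

lemma guessTrue_mem {δ : ℝ} (h : δ ≤ 1 / 2) (m : ℕ) (x y : List Bool) :
    δ ≤ guessTrue δ m x y ∧ guessTrue δ m x y ≤ 1 - δ := by
  unfold guessTrue
  split_ifs <;> constructor <;> linarith

lemma guessFalse_mem {δ : ℝ} (h : δ ≤ 1 / 2) (m : ℕ) (x y : List Bool) :
    δ ≤ guessFalse δ m x y ∧ guessFalse δ m x y ≤ 1 - δ := by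
  unfold guessFalse
  split_ifs
  · constructor <;> linarith
  · exact ⟨le_max_left _ _, max_le (by linarith) (min_le_left _ _)⟩
  · constructor <;> linarith

section Upper

variable {α β δ : ℝ}

lemma geom_le_one (hα : 0 < α ∧ α < 1) (m : ℕ) :
    ∑ b ∈ Finset.range m, (1 - α) ^ b * α ≤ 1 := by
  rw [← Finset.sum_mul]
  have h1 := geom_sum_mul (1 - α) m
  have h2 : 0 ≤ (1 - α) ^ m := pow_nonneg (sub_nonneg.2 hα.2.le) m
  linarith

lemma posEnt_true_le (hα : 0 < α ∧ α < 1) (hβ : 0 < β ∧ β < 1) (hδ : 0 < δ) (hδ2 : δ ≤ 1 / 2)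
    {h m n : ℕ} (hm : h ≤ m) (hn : 2 * m ≤ n + 1) (x : List Bool)
    (hx : x.length = n + 1) :
    posEnt α β x true ≤ -Real.log (1 - δ) + m * (β * -Real.log δ) + (1 - α) ^ m * -Real.log δ +
      -Real.log δ * (if Repetitive h m x then 1 else 0) := by
  set κ := -Real.log (1 - δ) with hκ
  set Λ := -Real.log δ with hΛ
  have hκ0 : 0 ≤ κ := by have := Real.log_nonpos (x := 1 - δ) (by linarith) (by linarith); linarith
  have hΛ0 : 0 ≤ Λ := by have := Real.log_nonpos hδ.le (by linarith); linarith
  have hΛβ : 0 ≤ m * (β * Λ) := mul_nonneg (by positivity) (mul_nonneg hβ.1.le hΛ0)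
  set c := κ + Λ * (if Repetitive h m x then 1 else 0) with hc
  have hc0 : 0 ≤ c := by positivity
  have hq : ∀ y, 0 < guessTrue δ m x y ∧ guessTrue δ m x y < 1 := fun y => by
    have := guessTrue_mem hδ2 m x y
    constructor <;> linarith
  refine (posEnt_le_chainExp hα hβ x hx true _ hq).trans ?_
  change chainExp α β (n + 1) true (fun d => guessCost (guessTrue δ m x (yList x d)) d) ≤ _
  have hle : ∀ d, guessCost (guessTrue δ m x (yList x d)) d ≤ Λ := fun d =>
    guessCost_le hδ (guessTrue_mem hδ2 m x _).1 (guessTrue_mem hδ2 m x _).2 d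
  refine (chainExp_true_le_sum hα hβ (Λ := Λ) m m (c := fun _ => c) (by omega)
    (fun d => guessCost_nonneg (hq _).1 (hq _).2 d) hle ?_).trans ?_
  · intro b hb d
    by_cases hrep : Repetitive h m x
    · refine (hle _).trans ?_
      rw [hc, if_pos hrep]
      linarith
    rw [hc, if_neg hrep, mul_zero, add_zero]
    have ht : (yList x (List.replicate b true ++ (List.replicate m false ++ d))).take m =
        (x.drop b).take m := by
      have := take_yList_burst (i := 0) (b := b) (m := m) (x := x) (d := d) (by omega) (by omega)
      simpa using this
    rcases Nat.eq_zero_or_pos b with rfl | hb0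
    · rw [List.drop_zero] at ht
      rw [guessTrue, if_pos ht, List.replicate_zero, List.nil_append,
        guessCost_false _ (by omega)]
    · have hne : ¬ (yList x (List.replicate b true ++ (List.replicate m false ++ d))).take m =
          x.take m := by
        intro he
        rw [ht] at he
        obtain ⟨e, rfl⟩ := Nat.exists_eq_succ_of_ne_zero hb0.ne'
        exact hrep ⟨0, by omega, e, by omega, by
          rw [List.drop_zero]; exact hm.trans (le_run (by omega) he)⟩
      rw [guessTrue, if_neg hne, guessCost_true _ hb0]
  · rw [← Finset.sum_mul]
    have h1 := mul_le_mul_of_nonneg_right (geom_le_one hα m) (add_nonneg hc0 hΛβ)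
    rw [hc] at h1 ⊢
    linarith

/-- The cost of the guess `1 / (r + 1)` when a burst occurs after `i` transmitted symbols. -/
def burstCost (i r : ℕ) : ℝ :=
  if i = 0 then Real.log (r + 1) else if i ≤ r then Real.log (((r : ℝ) + 1) / r) else 0

lemma burstCost_nonneg (i r : ℕ) : 0 ≤ burstCost i r := by
  unfold burstCost
  split_ifs with h1 h2
  · exact Real.log_nonneg (by linarith [(Nat.cast_nonneg r : (0 : ℝ) ≤ r)])
  · have : (0 : ℝ) < r := by exact_mod_cast (show 0 < r by omega)
    exact Real.log_nonneg (by rw [le_div_iff₀ this]; linarith)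
  · exact le_rfl

lemma sum_burstCost_le (m r : ℕ) : ∑ i ∈ Finset.range m, burstCost i r ≤ classEnt r := by
  have h1 : ∑ i ∈ Finset.range m, burstCost i r ≤
      ∑ i ∈ Finset.range (m + r + 1), burstCost i r :=
    Finset.sum_le_sum_of_subset_of_nonneg (Finset.range_mono (by omega))
      fun i _ _ => burstCost_nonneg i r
  refine h1.trans ?_
  rw [Finset.sum_range_succ']
  rcases Nat.eq_zero_or_pos r with rfl | hr
  · simp [burstCost]
  · rw [classEnt_eq hr, add_comm]
    have h2 : ∀ i, burstCost (i + 1) r =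
        if i ∈ Finset.range r then Real.log (((r : ℝ) + 1) / r) else 0 := by
      intro i
      simp only [burstCost, Finset.mem_range, Nat.succ_le_iff, Nat.succ_ne_zero, if_false]
    simp only [h2]
    rw [Finset.sum_ite_mem, Finset.inter_eq_right.2 (Finset.range_mono (by omega))]
    simp [burstCost]

lemma guessFalse_burst_le (hδ : 0 < δ) (hδ2 : δ ≤ 1 / 2) {h m : ℕ} (hm : 2 * h ≤ m)
    {x : List Bool} (hx : 4 * m ≤ x.length) (hrep : ¬ Repetitive h m x) {i b : ℕ} (hi : i < m)
    (hb : b < m) (d : List Bool) :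
    guessCost (guessFalse δ m x (yList x (List.replicate i false ++ (List.replicate (b + 1) true ++
      (List.replicate m false ++ d))))) (List.replicate i false ++ (List.replicate (b + 1) true ++
      (List.replicate m false ++ d))) ≤ -Real.log (1 - δ) + burstCost i (run b x) := by
  have hκ0 : Real.log (1 - δ) ≤ 0 := Real.log_nonpos (by linarith) (by linarith)
  have hrun : ∀ c ≤ 2 * m, ∀ e < m, run e (x.drop c) < h := fun c hc e he =>
    not_le.1 fun hr => hrep ⟨c, hc, e, he, hr⟩
  have hrun0 : ∀ e < m, run e x < h := fun e he => by simpa using hrun 0 (by omega) e he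
  have hsep : ∀ c ≤ m, ∀ e < m, ∀ e' < m, ∀ l, h ≤ l → l ≤ m →
      (x.drop (c + e + 1)).take l = (x.drop (c + e' + 1)).take l → e = e' := by
    intro c hc e he e' he' l hl hlm heq
    rw [add_right_comm c e, add_right_comm c e'] at heq
    rcases lt_trichotomy e e' with hlt | rfl | hlt
    · have h1 := le_run_drop (c := c + 1) hlt (by omega) heq
      have h2 := hrun (c + 1 + e) (by omega) (e' - e - 1) (by omega)
      omega
    · rfl
    · have h1 := le_run_drop (c := c + 1) hlt (by omega) heq.symm
      have h2 := hrun (c + 1 + e') (by omega) (e - e' - 1) (by omega)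
      omega
  have ht := take_yList_burst (i := i) (b := b + 1) (m := m) hi.le (x := x) (d := d) (by omega)
  set D := List.replicate i false ++ (List.replicate (b + 1) true ++
      (List.replicate m false ++ d)) with hD
  have hr := hrun0 b hb
  by_cases hir : i ≤ run b x
  · have ht2 : (yList x D).take m = (x.drop (b + 1)).take m := by
      rw [ht, ← take_drop_eq_take hir]
      have : x.drop (i + (b + 1)) = (x.drop (b + 1)).drop i := by
        rw [List.drop_drop, add_comm]
      rw [this, ← List.take_add, Nat.add_sub_cancel' hi.le]
    have hne : ¬ (yList x D).take m = x.take m := by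
      intro he
      have := le_run (by omega) (ht2.symm.trans he)
      omega
    have H : ∃ e < m, (yList x D).take m = (x.drop (e + 1)).take m := ⟨b, hb, ht2⟩
    have hch : H.choose = b := by
      obtain ⟨h1, h2⟩ := H.choose_spec
      refine hsep 0 (by omega) _ h1 b hb m (by omega) le_rfl ?_
      rw [zero_add, zero_add, ← h2, ht2]
    rw [guessFalse, if_neg hne, dif_pos H, hch]
    set r := run b x with hrd
    have hr0 : (0 : ℝ) ≤ r := Nat.cast_nonneg r
    rcases Nat.eq_zero_or_pos i with rfl | hi0
    · rw [hD, List.replicate_zero, List.nil_append, guessCost_true _ (by omega), burstCost,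
        if_pos rfl]
      have hlog : 0 ≤ Real.log ((r : ℝ) + 1) := Real.log_nonneg (by linarith)
      have h1 : min (1 - δ) (1 / ((r : ℝ) + 1)) ≤ max δ (min (1 - δ) (1 / ((r : ℝ) + 1))) :=
        le_max_right _ _
      have h2 : 0 < min (1 - δ) (1 / ((r : ℝ) + 1)) := lt_min (by linarith) (by positivity)
      have h3 := Real.log_le_log h2 h1
      rcases min_choice (1 - δ) (1 / ((r : ℝ) + 1)) with h4 | h4 <;> rw [h4] at h3
      · rw [h4]; linarith
      · rw [one_div, Real.log_inv] at h3
        rw [h4, one_div]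
        linarith
    · have hrp : (0 : ℝ) < r := by exact_mod_cast hi0.trans_le hir
      rw [guessCost_false _ hi0, burstCost, if_neg hi0.ne', if_pos hir]
      have hlog : 0 ≤ Real.log (((r : ℝ) + 1) / r) :=
        Real.log_nonneg (by rw [le_div_iff₀ hrp]; linarith)
      have hpos : 0 < 1 - max δ (min (1 - δ) (1 / ((r : ℝ) + 1))) := by
        rw [sub_pos, max_lt_iff]
        exact ⟨by linarith, (min_le_left _ _).trans_lt (by linarith)⟩
      rcases max_choice δ (min (1 - δ) (1 / ((r : ℝ) + 1))) with h4 | h4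
      · rw [h4]; linarith
      · rw [h4] at hpos ⊢
        have h5 : 1 - 1 / ((r : ℝ) + 1) ≤ 1 - min (1 - δ) (1 / ((r : ℝ) + 1)) := by
          linarith [min_le_right (1 - δ) (1 / ((r : ℝ) + 1))]
        have h6 : 1 - 1 / ((r : ℝ) + 1) = (((r : ℝ) + 1) / r)⁻¹ := by
          field_simp; ring
        have h7 := Real.log_le_log (by rw [h6]; positivity) h5
        rw [h6, Real.log_inv] at h7
        linarith
  · have hi0 : 0 < i := by omega
    have hg : guessFalse δ m x (yList x D) = δ := by
      rw [guessFalse]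
      split_ifs with hmatch H
      · rfl
      · exfalso
        obtain ⟨e, he, hye⟩ := H
        rw [ht] at hye
        have hlen : (x.take i).length = i := by simp; omega
        have h1 : x.take i = (x.drop (e + 1)).take i := by
          have := congrArg (List.take i) hye
          rwa [List.take_append_of_le_length (by omega), List.take_take, List.take_take, min_self,
            min_eq_left hi.le] at this
        have h2 : (x.drop (i + (b + 1))).take (m - i) = (x.drop (i + e + 1)).take (m - i) := by
          have := congrArg (List.drop i) hye
          rw [List.drop_append_of_le_length (by omega), List.drop_eq_nil_of_le (by omega),
            List.nil_append, List.drop_take, List.drop_drop] at this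
          rw [this, show e + 1 + i = i + e + 1 by omega]
        have h3 := le_run (by omega) h1.symm
        have h4 := hrun0 e he
        have h5 : b = e := hsep i hi.le b hb e he (m - i) (by omega) (by omega) h2
        subst h5
        omega
      · rfl
    rw [hg, guessCost_false _ hi0]
    linarith [burstCost_nonneg i (run b x)]

end Upper

section Upper

variable {α β δ : ℝ}

lemma posEnt_false_le (hα : 0 < α ∧ α < 1) (hβ : 0 < β ∧ β < 1) (hδ : 0 < δ) (hδ2 : δ ≤ 1 / 2)
    {h m n : ℕ} (hh : 0 < h) (hm : 2 * h ≤ m) (hn : 4 * m ≤ n + 1) (x : List Bool)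
    (hx : x.length = n + 1) :
    posEnt α β x false ≤ -Real.log (1 - δ) +
      m * (β * (-Real.log (1 - δ) + m * (β * -Real.log δ) + (1 - α) ^ m * -Real.log δ)) +
      m * (β * -Real.log δ) * (if Repetitive h m x then 1 else 0) +
      β * ∑ b ∈ Finset.range m, (1 - α) ^ b * α * classEnt (min h (run b x)) := by
  set κ := -Real.log (1 - δ) with hκ
  set Λ := -Real.log δ with hΛ
  have hκ0 : 0 ≤ κ := by have := Real.log_nonpos (x := 1 - δ) (by linarith) (by linarith); linarith
  have hΛ0 : 0 ≤ Λ := by have := Real.log_nonpos hδ.le (by linarith); linarith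
  have hα0 : 0 ≤ 1 - α := sub_nonneg.2 hα.2.le
  have hαp := hα.1.le
  have hβp := hβ.1.le
  have hq : ∀ y, 0 < guessFalse δ m x y ∧ guessFalse δ m x y < 1 := fun y => by
    have := guessFalse_mem hδ2 m x y
    constructor <;> linarith
  refine (posEnt_le_chainExp hα hβ x hx false _ hq).trans ?_
  change chainExp α β (n + 1) false (fun d => guessCost (guessFalse δ m x (yList x d)) d) ≤ _
  have hle : ∀ d, guessCost (guessFalse δ m x (yList x d)) d ≤ Λ := fun d =>
    guessCost_le hδ (guessFalse_mem hδ2 m x _).1 (guessFalse_mem hδ2 m x _).2 d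
  have hnn : ∀ d, 0 ≤ guessCost (guessFalse δ m x (yList x d)) d := fun d =>
    guessCost_nonneg (hq _).1 (hq _).2 d
  have hzero : ∀ d, guessCost (guessFalse δ m x (yList x (List.replicate m false ++ d)))
      (List.replicate m false ++ d) ≤ κ := by
    intro d
    have ht : (yList x (List.replicate m false ++ d)).take m = x.take m := by
      have := take_yList_burst (i := 0) (b := 0) (m := m) (x := x) (d := d) (by omega) (by omega)
      simpa using this
    rw [guessFalse, if_pos ht, guessCost_false _ (by omega)]
  have hent : 0 ≤ β * ∑ b ∈ Finset.range m, (1 - α) ^ b * α * classEnt (min h (run b x)) :=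
    mul_nonneg hβp (Finset.sum_nonneg fun b _ => mul_nonneg (by positivity) (classEnt_nonneg _))
  have hrest : 0 ≤ m * (β * (κ + m * (β * Λ) + (1 - α) ^ m * Λ)) := by positivity
  by_cases hrep : Repetitive h m x
  · rw [if_pos hrep]
    have := chainExp_false_le hα hβ (k := m) (n := n + 1) (by omega) hnn hle hzero
    linarith
  rw [if_neg hrep]
  have hburst : ∀ i ∈ Finset.range m, β * chainExp α β (n + 1 - i - 1) true (fun d =>
      guessCost (guessFalse δ m x (yList x (List.replicate i false ++ true :: d)))
        (List.replicate i false ++ true :: d)) ≤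
      β * (κ + m * (β * Λ) + (1 - α) ^ m * Λ) +
        β * ∑ b ∈ Finset.range m, (1 - α) ^ b * α * burstCost i (run b x) := by
    intro i hi
    have him := Finset.mem_range.1 hi
    have h1 := chainExp_true_le_sum hα hβ (Λ := Λ) m m (n := n + 1 - i - 1)
      (c := fun b => κ + burstCost i (run b x))
      (F := fun d => guessCost (guessFalse δ m x (yList x (List.replicate i false ++ true :: d)))
        (List.replicate i false ++ true :: d)) (by omega) (fun d => hnn _) (fun d => hle _)
      (fun b hb d => by
        simpa only [List.replicate_succ, List.cons_append] using
          guessFalse_burst_le hδ hδ2 hm (by omega) hrep him hb d)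
    have h2 : ∀ b, (1 - α) ^ b * α * (κ + burstCost i (run b x) + m * (β * Λ)) =
        (1 - α) ^ b * α * (κ + m * (β * Λ)) + (1 - α) ^ b * α * burstCost i (run b x) :=
      fun b => by ring
    simp only [h2] at h1
    rw [Finset.sum_add_distrib, ← Finset.sum_mul] at h1
    have h3 := mul_le_mul_of_nonneg_right (geom_le_one hα m)
      (show 0 ≤ κ + m * (β * Λ) by positivity)
    rw [← mul_add]
    refine mul_le_mul_of_nonneg_left ?_ hβp
    linarith
  refine (chainExp_false_le_sum hα hβ m (by omega) hnn hzero).trans ?_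
  have h4 := Finset.sum_le_sum hburst
  rw [Finset.sum_add_distrib, Finset.sum_const, Finset.card_range, nsmul_eq_mul,
    ← Finset.mul_sum, ← Finset.mul_sum, Finset.sum_comm] at h4
  have h5 : ∑ b ∈ Finset.range m, ∑ i ∈ Finset.range m,
      (1 - α) ^ b * α * burstCost i (run b x) ≤
      ∑ b ∈ Finset.range m, (1 - α) ^ b * α * classEnt (min h (run b x)) := by
    refine Finset.sum_le_sum fun b hb => ?_
    have hr : run b x < h := not_le.1 fun hr =>
      hrep ⟨0, by omega, b, Finset.mem_range.1 hb, by simpa using hr⟩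
    rw [← Finset.mul_sum, min_eq_right hr.le]
    exact mul_le_mul_of_nonneg_left (sum_burstCost_le m _) (by positivity)
  have h6 := mul_le_mul_of_nonneg_left h5 hβp
  rw [← Finset.mul_sum]
  linarith

lemma posEntLim_le (hα : 0 < α ∧ α < 1) (hβ : 0 < β ∧ β < 1) (hδ : 0 < δ) (hδ2 : δ ≤ 1 / 2)
    {h m : ℕ} (hh : 0 < h) (hm : 2 * h ≤ m) {κ Λ p : ℝ} (hκ : κ = -Real.log (1 - δ))
    (hΛ : Λ = -Real.log δ) (hp : p = (2 * m + 1) * m * (1 / 2 : ℝ) ^ h) :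
    posEntLim α β ≤ β * Cnat + κ + m * (β * (κ + m * (β * Λ) + (1 - α) ^ m * Λ + p * Λ)) +
      β / α * (κ + m * (β * Λ) + (1 - α) ^ m * Λ + p * Λ) := by
  have hκ0 : 0 ≤ κ := by
    have := Real.log_nonpos (x := 1 - δ) (by linarith) (by linarith); linarith
  have hΛ0 : 0 ≤ Λ := by have := Real.log_nonpos hδ.le (by linarith); linarith
  have hα0 : 0 ≤ 1 - α := sub_nonneg.2 hα.2.le
  have hαp := hα.1
  have hβp := hβ.1
  have hp0 : 0 ≤ p := by rw [hp]; positivity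
  refine ciSup_le fun n₀ => ?_
  set n := n₀ + 4 * m with hn
  refine (posEntAvg_mono hα hβ (show n₀ ≤ n by omega)).trans ?_
  have hrep := avg_repetitive_le (h := h) (m := m) (n := n + 1) (by omega)
  rw [← hp] at hrep
  have hF : avg (n + 1) (fun x => posEnt α β x false) ≤ κ +
      m * (β * (κ + m * (β * Λ) + (1 - α) ^ m * Λ)) + m * (β * Λ) * p + β * Cnat := by
    have h1 := avg_mono (n := n + 1) fun x hx =>
      posEnt_false_le hα hβ hδ hδ2 hh hm (by omega) x hx
    rw [← hκ, ← hΛ] at h1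
    refine h1.trans ?_
    rw [avg_add, avg_add, avg_const, avg_const_mul, avg_const_mul, avg_sum]
    have h2 : ∑ b ∈ Finset.range m, avg (n + 1) (fun x => (1 - α) ^ b * α *
        classEnt (min h (run b x))) ≤ Cnat := by
      have h3 : ∀ b ∈ Finset.range m, avg (n + 1) (fun x => (1 - α) ^ b * α *
          classEnt (min h (run b x))) ≤ (1 - α) ^ b * α * Cnat := by
        intro b hb
        have := Finset.mem_range.1 hb
        rw [avg_const_mul, avg_classEnt_min (by omega)]
        exact mul_le_mul_of_nonneg_left (partC_le_Cnat h) (by positivity)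
      refine (Finset.sum_le_sum h3).trans ?_
      rw [← Finset.sum_mul]
      exact mul_le_of_le_one_left Cnat_nonneg (geom_le_one hα m)
    have h4 := mul_le_mul_of_nonneg_left h2 hβp.le
    have h5 := mul_le_mul_of_nonneg_left hrep (show 0 ≤ m * (β * Λ) by positivity)
    linarith
  have hT : avg (n + 1) (fun x => posEnt α β x true) ≤
      κ + m * (β * Λ) + (1 - α) ^ m * Λ + p * Λ := by
    have h1 := avg_mono (n := n + 1) fun x hx =>
      posEnt_true_le hα hβ hδ hδ2 (h := h) (m := m) (by omega) (by omega) x hx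
    rw [← hκ, ← hΛ] at h1
    refine h1.trans ?_
    rw [avg_add, avg_const, avg_const_mul]
    have h5 := mul_le_mul_of_nonneg_left hrep hΛ0
    linarith
  have hsplit : posEntAvg α β n = β / (α + β) * avg (n + 1) (fun x => posEnt α β x true) +
      α / (α + β) * avg (n + 1) (fun x => posEnt α β x false) := by
    rw [posEntAvg]
    simp only [Fintype.sum_bool]
    rw [avg_add, avg_const_mul, avg_const_mul]
    simp [initD]
  rw [hsplit]
  have hT0 : 0 ≤ κ + m * (β * Λ) + (1 - α) ^ m * Λ + p * Λ := by positivity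
  have hF0 : 0 ≤ κ + m * (β * (κ + m * (β * Λ) + (1 - α) ^ m * Λ)) + m * (β * Λ) * p +
      β * Cnat := by have := Cnat_nonneg; positivity
  have h6 : β / (α + β) ≤ β / α := div_le_div_of_nonneg_left hβp.le hαp (by linarith)
  have h7 : α / (α + β) ≤ 1 := (div_le_one (by linarith)).2 (by linarith)
  have h8 := (mul_le_mul_of_nonneg_left hT (show 0 ≤ β / (α + β) by positivity)).trans
    (mul_le_mul_of_nonneg_right h6 hT0)
  have h9 := (mul_le_mul_of_nonneg_left hF (show 0 ≤ α / (α + β) by positivity)).trans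
    (mul_le_mul_of_nonneg_right h7 hF0)
  linarith

end Upper

/-! ### Asymptotics for rare deletions -/

lemma pow_ceil_le {a γ β : ℝ} (ha : 0 < a) (hβ : 0 < β) (hγ : 0 < γ) (hγa : γ ≤ -Real.log a) :
    a ^ ⌈-Real.log β / γ⌉₊ ≤ β := by
  have h1 := Nat.le_ceil (-Real.log β / γ)
  rw [div_le_iff₀ hγ] at h1
  rw [← Real.log_le_log_iff (by positivity) hβ, Real.log_pow]
  have h2 := mul_le_mul_of_nonneg_left hγa (Nat.cast_nonneg (α := ℝ) ⌈-Real.log β / γ⌉₊)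
  linarith

lemma one_le_neg_log {β : ℝ} (hβ0 : 0 < β) (hβ : β < 1 / 4) : 1 ≤ -Real.log β := by
  have h1 := Real.log_le_log hβ0 hβ.le
  have h2 : Real.log (1 / 4) = -(2 * Real.log 2) := by
    rw [one_div, Real.log_inv, show (4 : ℝ) = 2 ^ 2 by norm_num, Real.log_pow]
    norm_num
  have := Real.log_two_gt_d9
  linarith

lemma neg_log_one_sub_le {t : ℝ} (h0 : 0 ≤ t) (h1 : t ≤ 1 / 2) : -Real.log (1 - t) ≤ 2 * t := by
  have h2 := Real.one_sub_inv_le_log_of_pos (show 0 < 1 - t by linarith)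
  have h3 : (1 - t)⁻¹ ≤ 1 + 2 * t := by
    rw [inv_le_iff_one_le_mul₀ (by linarith)]
    nlinarith
  linarith

section Asymptotics

variable {α : ℝ}

lemma posEntLim_sub_le (hα : 0 < α ∧ α < 1) {β A : ℝ} (hβ0 : 0 < β) (hβ : β < 1 / 4) {h : ℕ}
    (hh : 0 < h) (h2 : (1 / 2 : ℝ) ^ h ≤ β) (hα2 : (1 - α) ^ h ≤ β) (hA : 1 ≤ A)
    (hhA : h ≤ A * -Real.log β) :
    posEntLim α β - β * Cnat ≤ (66 * A ^ 3 + 32 * A ^ 2 / α) * (β ^ 2 * (-Real.log β) ^ 4) := by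
  set L := -Real.log β with hL
  have hL1 : 1 ≤ L := one_le_neg_log hβ0 hβ
  have hα0 : 0 ≤ 1 - α := sub_nonneg.2 hα.2.le
  have hαp := hα.1
  have hsq : β ^ 2 ≤ 1 / 2 := by nlinarith
  set κ := -Real.log (1 - β ^ 2) with hκ
  set m : ℕ := 2 * h with hm
  set p := (2 * (m : ℝ) + 1) * m * (1 / 2 : ℝ) ^ h with hp
  have hΛ : 2 * L = -Real.log (β ^ 2) := by rw [Real.log_pow, hL]; push_cast; ring
  have hmain := posEntLim_le hα ⟨hβ0, by linarith⟩ (δ := β ^ 2) (by positivity) hsq hh hm.ge hκ hΛ hp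
  have hκ2 : κ ≤ 2 * β ^ 2 := neg_log_one_sub_le (by positivity) hsq
  have hmA : (m : ℝ) ≤ 2 * (A * L) := by rw [hm]; push_cast; linarith
  have hm1 : (1 : ℝ) ≤ m := by exact_mod_cast (show 1 ≤ m by omega)
  have hAL : 1 ≤ A * L := by nlinarith
  have hαm : (1 - α) ^ m ≤ β :=
    (pow_le_pow_of_le_one hα0 (by linarith) (by omega)).trans hα2
  have hpb : p ≤ 12 * (A * L) ^ 2 * β := by
    have h3 : (2 * (m : ℝ) + 1) * m ≤ 3 * m ^ 2 := by nlinarith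
    have h4 : (m : ℝ) ^ 2 ≤ (2 * (A * L)) ^ 2 := by gcongr
    calc p ≤ (3 * m ^ 2) * β := by rw [hp]; gcongr
      _ ≤ (3 * (2 * (A * L)) ^ 2) * β := by gcongr
      _ = _ := by ring
  set T := κ + m * (β * (2 * L)) + (1 - α) ^ m * (2 * L) + p * (2 * L) with hT
  have hT2 : T ≤ 32 * A ^ 2 * (β * L ^ 3) := by
    have e1 : κ ≤ 2 * (A ^ 2 * (β * L ^ 3)) := by
      refine hκ2.trans ?_
      have : β * β ≤ β * (A ^ 2 * L ^ 3) := by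
        refine mul_le_mul_of_nonneg_left ?_ hβ0.le
        have : 1 ≤ A ^ 2 * L ^ 3 := one_le_mul_of_one_le_of_one_le (one_le_pow₀ hA) (one_le_pow₀ hL1)
        linarith
      linarith
    have e2 : m * (β * (2 * L)) ≤ 4 * (A ^ 2 * (β * L ^ 3)) := by
      calc m * (β * (2 * L)) ≤ 2 * (A * L) * (β * (2 * L)) := by gcongr
        _ = 4 * (A ^ 1 * (β * L ^ 2)) := by ring
        _ ≤ 4 * (A ^ 2 * (β * L ^ 3)) := by
          gcongr <;> first | assumption | norm_num
    have e3 : (1 - α) ^ m * (2 * L) ≤ 2 * (A ^ 2 * (β * L ^ 3)) := by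
      calc (1 - α) ^ m * (2 * L) ≤ β * (2 * L) := by gcongr
        _ = 2 * (1 * (β * L ^ 1)) := by ring
        _ ≤ 2 * (A ^ 2 * (β * L ^ 3)) := by
          gcongr
          · exact one_le_pow₀ hA
          · norm_num
    have e4 : p * (2 * L) ≤ 24 * (A ^ 2 * (β * L ^ 3)) := by
      calc p * (2 * L) ≤ 12 * (A * L) ^ 2 * β * (2 * L) := by gcongr
        _ = _ := by ring
    rw [hT]
    linarith
  have hfin1 : κ ≤ 2 * (A ^ 3 * (β ^ 2 * L ^ 4)) := by
    refine hκ2.trans ?_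
    have : 1 ≤ A ^ 3 * L ^ 4 := one_le_mul_of_one_le_of_one_le (one_le_pow₀ hA) (one_le_pow₀ hL1)
    have := mul_le_mul_of_nonneg_left this (sq_nonneg β)
    linarith
  have hfin2 : m * (β * T) ≤ 64 * (A ^ 3 * (β ^ 2 * L ^ 4)) := by
    calc m * (β * T) ≤ m * (β * (32 * A ^ 2 * (β * L ^ 3))) := by gcongr
      _ ≤ 2 * (A * L) * (β * (32 * A ^ 2 * (β * L ^ 3))) := by gcongr
      _ = _ := by ring
  have hfin3 : β / α * T ≤ 32 * A ^ 2 / α * (β ^ 2 * L ^ 4) := by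
    calc β / α * T ≤ β / α * (32 * A ^ 2 * (β * L ^ 3)) := by gcongr
      _ = 32 * A ^ 2 / α * (β ^ 2 * L ^ 3) := by ring
      _ ≤ 32 * A ^ 2 / α * (β ^ 2 * L ^ 4) := by
        gcongr
        · norm_num
  linarith

lemma le_posEntLim_sub (hα : 0 < α ∧ α < 1) {β A : ℝ} (hβ0 : 0 < β) (hβ : β < 1 / 4) {h : ℕ}
    (h2 : (1 / 2 : ℝ) ^ h ≤ β) (hα2 : (1 - α) ^ h ≤ β) (hA : 1 ≤ A)
    (hhA : h ≤ A * -Real.log β) :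
    β * Cnat - posEntLim α β ≤ (6 + 2 / α + 4 * A) * (β ^ 2 * (-Real.log β) ^ 4) := by
  set L := -Real.log β with hL
  have hL1 : 1 ≤ L := one_le_neg_log hβ0 hβ
  have hα0 : 0 ≤ 1 - α := sub_nonneg.2 hα.2.le
  have hαp := hα.1
  have hmain := posEntLim_ge hα ⟨hβ0, by linarith⟩ h
  set P := α / (α + β) with hP
  set Q := (1 - β) ^ (2 * h + 1) with hQ
  set R := 1 - (1 - α) ^ h with hR
  have hP0 : 0 ≤ P := by positivity
  have hP1 : P ≤ 1 := (div_le_one (by linarith)).2 (by linarith)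
  have hP2 : 1 - β / α ≤ P := by
    rw [hP, le_div_iff₀ (by linarith)]
    have : (1 - β / α) * (α + β) = α - β * β / α := by field_simp; ring
    rw [this]
    have : 0 ≤ β * β / α := by positivity
    linarith
  have hQ0 : 0 ≤ Q := pow_nonneg (by linarith) _
  have hQ1 : Q ≤ 1 := pow_le_one₀ (by linarith) (by linarith)
  have hQ2 : 1 - (2 * h + 1) * β ≤ Q := by
    have := one_add_mul_le_pow (a := -β) (by linarith) (2 * h + 1)
    push_cast at this
    rw [← sub_eq_add_neg] at this
    linarith
  have hR1 : 1 - β ≤ R := by linarith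
  have hR0 : 0 ≤ R := by linarith
  have hR2 : R ≤ 1 := by have := pow_nonneg hα0 h; linarith
  have hC0 : 0 ≤ partC h := by
    have := partC_mono (Nat.zero_le h)
    simpa [partC] using this
  have hC2 : partC h ≤ 2 := (partC_le_Cnat h).trans Cnat_le_two
  have hC3 : Cnat - 2 * β ≤ partC h := by have := Cnat_le_partC h; linarith
  have hPQ : 1 - β / α - (2 * h + 1) * β ≤ P * Q := by nlinarith
  have hPQR : 1 - β / α - (2 * h + 1) * β - β ≤ P * Q * R := by
    have h3 : P * Q ≤ 1 := mul_le_one₀ hP1 hQ0 hQ1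
    have h4 : 0 ≤ P * Q := by positivity
    nlinarith
  have hs : 0 ≤ β / α + (2 * h + 1) * β + β := by positivity
  have hprod : Cnat - 2 * β - 2 * (β / α + (2 * h + 1) * β + β) ≤ P * Q * R * partC h := by
    have h3 := mul_le_mul_of_nonneg_right hPQR hC0
    have h4 := mul_le_mul_of_nonneg_left hC2 hs
    linarith
  have h5 := mul_le_mul_of_nonneg_left hprod hβ0.le
  have h6 : P * (β * Q * (R * partC h)) = β * (P * Q * R * partC h) := by ring
  have h7 : β * Cnat - posEntLim α β ≤ (6 + 2 / α + 4 * h) * β ^ 2 := by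
    have : β * (Cnat - 2 * β - 2 * (β / α + (2 * h + 1) * β + β)) =
      β * Cnat - (6 + 2 / α + 4 * h) * β ^ 2 := by ring
    linarith
  refine h7.trans ?_
  have hL4 : 1 ≤ L ^ 4 := one_le_pow₀ hL1
  have hLL : L ≤ L ^ 4 := le_self_pow₀ hL1 (by norm_num)
  have h8 : 6 + 2 / α + 4 * h ≤ (6 + 2 / α + 4 * A) * L ^ 4 := by
    have e1 : 0 ≤ 6 + 2 / α := by positivity
    have e2 := mul_le_mul_of_nonneg_left hL4 e1
    have e3 := mul_le_mul_of_nonneg_left hLL (show 0 ≤ A by linarith)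
    linarith
  have := mul_le_mul_of_nonneg_right h8 (sq_nonneg β)
  linarith

lemma exists_posEntLim_bound (hα : 0 < α ∧ α < 1) : ∃ M : ℝ, 0 < M ∧ ∀ β : ℝ, 0 < β → β < 1 / 4 →
    |posEntLim α β - β * Cnat| ≤ M * (β ^ 2 * (-Real.log β) ^ 4) := by
  have hαp := hα.1
  set γ := min (Real.log 2) (-Real.log (1 - α)) with hγ
  have hγ0 : 0 < γ := lt_min (Real.log_pos (by norm_num))
    (neg_pos.2 (Real.log_neg (by linarith [hα.2]) (by linarith)))
  set A := 1 / γ + 1 with hA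
  have hA1 : 1 ≤ A := by
    have : 0 < 1 / γ := by positivity
    linarith
  refine ⟨(66 * A ^ 3 + 32 * A ^ 2 / α) + (6 + 2 / α + 4 * A), by positivity, fun β hβ0 hβ => ?_⟩
  have hL1 := one_le_neg_log hβ0 hβ
  set h := ⌈-Real.log β / γ⌉₊ with hh
  have hh0 : 0 < h := Nat.ceil_pos.2 (by positivity)
  have h2 : (1 / 2 : ℝ) ^ h ≤ β := pow_ceil_le (by norm_num) hβ0 hγ0
    (by rw [one_div, Real.log_inv, neg_neg]; exact min_le_left _ _)
  have hα2 : (1 - α) ^ h ≤ β := pow_ceil_le (by linarith [hα.2]) hβ0 hγ0 (min_le_right _ _)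
  have hhA : (h : ℝ) ≤ A * -Real.log β := by
    have h3 := Nat.ceil_lt_add_one (show 0 ≤ -Real.log β / γ by positivity)
    rw [← hh] at h3
    have h4 : A * -Real.log β = -Real.log β / γ + -Real.log β := by rw [hA]; ring
    linarith
  have hup := posEntLim_sub_le hα hβ0 hβ hh0 h2 hα2 hA1 hhA
  have hlo := le_posEntLim_sub hα hβ0 hβ h2 hα2 hA1 hhA
  have hX : 0 ≤ β ^ 2 * (-Real.log β) ^ 4 := by positivity
  have c1 : 0 ≤ (66 * A ^ 3 + 32 * A ^ 2 / α) * (β ^ 2 * (-Real.log β) ^ 4) := by positivity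
  have c2 : 0 ≤ (6 + 2 / α + 4 * A) * (β ^ 2 * (-Real.log β) ^ 4) := by positivity
  rw [abs_le]
  constructor <;> linarith

lemma exists_chainRate_bound (hα : 0 < α ∧ α < 1) : ∃ M : ℝ, 0 < M ∧ ∀ β : ℝ, 0 < β → β < 1 / 4 →
    |initD α β false * Real.log 2 - chainRate α β - (Real.log 2 + β * Real.log β -
      β * ((Real.log 2 + (Real.negMulLog α + Real.negMulLog (1 - α))) / α + 1))| ≤
      M * (β ^ 2 * (-Real.log β) ^ 4) := by
  have hαp := hα.1
  set η := Real.negMulLog α + Real.negMulLog (1 - α) with hη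
  have hη0 : 0 ≤ η := add_nonneg (Real.negMulLog_nonneg hαp.le hα.2.le)
    (Real.negMulLog_nonneg (by linarith [hα.2]) (by linarith))
  have h2 : 0 < Real.log 2 := Real.log_pos (by norm_num)
  refine ⟨(Real.log 2 + η) / α ^ 2 + 2 / α + 1, by positivity, fun β hβ0 hβ => ?_⟩
  have hL1 := one_le_neg_log hβ0 hβ
  set L := -Real.log β with hL
  set ν := Real.negMulLog (1 - β) with hν
  set d := β / (α + β) with hd
  have hd0 : 0 ≤ d := by positivity
  have hd1 : d ≤ β / α := div_le_div_of_nonneg_left hβ0.le hαp (by linarith)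
  have hd2 : 0 ≤ β / α - d := by linarith
  have hd3 : β / α - d ≤ β ^ 2 / α ^ 2 := by
    have : β / α - d = β ^ 2 / (α * (α + β)) := by rw [hd]; field_simp; ring
    rw [this]
    refine div_le_div_of_nonneg_left (by positivity) (by positivity) ?_
    nlinarith
  have hνlo : β - β ^ 2 ≤ ν := by
    have h3 := Real.log_le_sub_one_of_pos (show 0 < 1 - β by linarith)
    have h4 := mul_le_mul_of_nonneg_left h3 (show 0 ≤ 1 - β by linarith)
    rw [hν, Real.negMulLog]
    linarith
  have hνhi : ν ≤ β := by
    have h3 := Real.one_sub_inv_le_log_of_pos (show 0 < 1 - β by linarith)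
    have h4 := mul_le_mul_of_nonneg_left h3 (show 0 ≤ 1 - β by linarith)
    rw [mul_sub, mul_inv_cancel₀ (by linarith)] at h4
    rw [hν, Real.negMulLog]
    linarith
  have hν0 : 0 ≤ ν := by nlinarith
  have hid : initD α β false = 1 - d := by
    rw [hd]
    simp only [initD, Bool.false_eq_true, if_false]
    rw [eq_sub_iff_add_eq, ← add_div, div_self (by positivity)]
  have hrate : chainRate α β = (1 - d) * (β * L + ν) + d * η := by
    rw [chainRate, Fintype.sum_bool, Fintype.sum_bool, Fintype.sum_bool, hid]
    simp only [initD, transD, if_true, Bool.false_eq_true, if_false]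
    rw [hη, hν, ← hd, hL, Real.negMulLog, Real.negMulLog, Real.negMulLog, Real.negMulLog]
    ring
  have hdiff : initD α β false * Real.log 2 - chainRate α β - (Real.log 2 + β * Real.log β -
      β * ((Real.log 2 + η) / α + 1)) =
      (Real.log 2 + η) * (β / α - d) + d * (β * L) + (β - ν) + d * ν := by
    rw [hid, hrate, show Real.log β = -L by rw [hL, neg_neg]]
    ring
  rw [hdiff]
  have e1 : (Real.log 2 + η) * (β / α - d) ≤ (Real.log 2 + η) / α ^ 2 * β ^ 2 := by
    have := mul_le_mul_of_nonneg_left hd3 (show 0 ≤ Real.log 2 + η by positivity)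
    refine this.trans_eq ?_
    ring
  have e1' : 0 ≤ (Real.log 2 + η) * (β / α - d) := by positivity
  have e2 : d * (β * L) ≤ 1 / α * (β ^ 2 * L) := by
    have := mul_le_mul_of_nonneg_right hd1 (show 0 ≤ β * L by positivity)
    refine this.trans_eq ?_
    ring
  have e4 : d * ν ≤ 1 / α * β ^ 2 := by
    have := mul_le_mul hd1 hνhi hν0 (by positivity)
    refine this.trans_eq ?_
    ring
  have e5 : β ^ 2 ≤ β ^ 2 * L ^ 4 := le_mul_of_one_le_right (sq_nonneg β) (one_le_pow₀ hL1)
  have e6 : β ^ 2 * L ≤ β ^ 2 * L ^ 4 :=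
    mul_le_mul_of_nonneg_left (le_self_pow₀ hL1 (by norm_num)) (sq_nonneg β)
  have e7 := mul_le_mul_of_nonneg_left e5 (show 0 ≤ (Real.log 2 + η) / α ^ 2 by positivity)
  have e8 := mul_le_mul_of_nonneg_left e5 (show 0 ≤ 1 / α by positivity)
  have e9 := mul_le_mul_of_nonneg_left e6 (show 0 ≤ 1 / α by positivity)
  have e10 : 0 ≤ d * (β * L) := by positivity
  have e11 : 0 ≤ d * ν := by positivity
  have e12 : 2 / α * (β ^ 2 * L ^ 4) = 1 / α * (β ^ 2 * L ^ 4) + 1 / α * (β ^ 2 * L ^ 4) := by ring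
  rw [abs_le]
  constructor
  · have : 0 ≤ ((Real.log 2 + η) / α ^ 2 + 2 / α + 1) * (β ^ 2 * L ^ 4) := by positivity
    linarith
  · linarith

lemma sq_mul_log_pow_le {β ε : ℝ} (hβ0 : 0 < β) (hβ : β < 1 / 4) (hε : 0 < ε) :
    β ^ 2 * (-Real.log β) ^ 4 ≤ (4 / ε) ^ 4 * β ^ (2 - ε) := by
  have hL1 := one_le_neg_log hβ0 hβ
  have h1 := Real.log_le_rpow_div (x := β⁻¹) (by positivity) (ε := ε / 4) (by positivity)
  rw [Real.log_inv] at h1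
  have h2 : (-Real.log β) ^ 4 ≤ ((β⁻¹) ^ (ε / 4) / (ε / 4)) ^ 4 :=
    pow_le_pow_left₀ (by linarith) h1 4
  have h3 : ((β⁻¹) ^ (ε / 4)) ^ 4 = β ^ (-ε) := by
    rw [← Real.rpow_natCast, ← Real.rpow_mul (by positivity), Real.inv_rpow hβ0.le,
      Real.rpow_neg hβ0.le]
    congr 2
    push_cast
    ring
  have h4 : β ^ (2 - ε) = β ^ 2 * β ^ (-ε) := by
    rw [sub_eq_add_neg, Real.rpow_add hβ0, ← Real.rpow_natCast]
    norm_num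
  rw [div_pow, h3] at h2
  have h5 := mul_le_mul_of_nonneg_left h2 (sq_nonneg β)
  refine h5.trans_eq ?_
  rw [h4]
  field_simp

end Asymptotics

/-- Fix `α ∈ (0,1)`. For every `β ∈ (0,1)` the limit
`I_∞(α,β) = lim_n (1/n)(H(y(X^n,D^n)) − H(y(X^n,D^n)|X^n))` exists, and for every
`ε > 0` there are `K > 0`, `β₀ > 0` such that for all `β ∈ (0, β₀)`:
`|I_∞(α,β) − (1 + β log₂ β − β((1+h₂(α))/α + log₂ e − C))| ≤ K β^{2−ε}`. -/
theorem mutual_information_asymptotic (α : ℝ) (hα : 0 < α ∧ α < 1) :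
    ∃ Iinf : ℝ → ℝ,
      (∀ β : ℝ, 0 < β → β < 1 →
        Tendsto (fun n : ℕ => Iseq α β n) atTop (nhds (Iinf β))) ∧
      ∀ ε : ℝ, 0 < ε → ∃ K : ℝ, 0 < K ∧ ∃ β₀ : ℝ, 0 < β₀ ∧ ∀ β : ℝ, 0 < β → β < β₀ →
        |Iinf β - (1 + β * Real.logb 2 β -
            β * ((1 + binEnt α) / α + Real.logb 2 (Real.exp 1) - Cconst))|
          ≤ K * β ^ ((2 : ℝ) - ε) := by
  refine ⟨fun β => initD α β false - (chainRate α β - posEntLim α β) / Real.log 2,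
    fun β h0 h1 => tendsto_Iseq hα ⟨h0, h1⟩, fun ε hε => ?_⟩
  obtain ⟨M₁, hM₁, hb₁⟩ := exists_posEntLim_bound hα
  obtain ⟨M₂, hM₂, hb₂⟩ := exists_chainRate_bound hα
  have h2 : 0 < Real.log 2 := Real.log_pos (by norm_num)
  refine ⟨(M₁ + M₂) * (4 / ε) ^ 4 / Real.log 2, by positivity, 1 / 4, by norm_num,
    fun β hβ0 hβ => ?_⟩
  have e1 := hb₁ β hβ0 hβ
  have e2 := hb₂ β hβ0 hβ
  have hsplit : initD α β false - (chainRate α β - posEntLim α β) / Real.log 2 -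
      (1 + β * Real.logb 2 β -
        β * ((1 + binEnt α) / α + Real.logb 2 (Real.exp 1) - Cconst)) =
      ((posEntLim α β - β * Cnat) + (initD α β false * Real.log 2 - chainRate α β -
        (Real.log 2 + β * Real.log β - β * ((Real.log 2 +
          (Real.negMulLog α + Real.negMulLog (1 - α))) / α + 1)))) / Real.log 2 := by
    have hαp := hα.1
    simp only [binEnt, Real.logb, Real.log_exp, Cnat, Real.negMulLog]
    field_simp
    ring
  rw [hsplit, abs_div, abs_of_pos h2, div_mul_eq_mul_div]
  refine div_le_div_of_nonneg_right ?_ h2.le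
  have e3 := mul_le_mul_of_nonneg_left (sq_mul_log_pow_le hβ0 hβ hε) (show 0 ≤ M₁ + M₂ by positivity)
  refine (abs_add_le _ _).trans ?_
  linarith
end SyncDeletion
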